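/- Let a<b be real, let ψ : ℝ → ]0,+∞[ be a bounded Borel function with ∫_{−∞}^{+∞} ψ(t) dt < +∞ and inf_K ψ > 0 for every compact K ⊂ ℝ, and let {u_k} be a sequence in X¹_ψ(]a,b[) bounded in L¹(]a,b[) with sup_k F̄₁(u_k) < +∞, where F̄₁ is the L¹-relaxation of F₁. Then there exist a subsequence (not relabeled) and u ∈ X¹_ψ(]a,b[) such that u_k ⇀ u weakly* in BV(]a,b[), Ψ₁∘(u_k')^a ⇀ Ψ₁∘(u')^a weakly* in BV(]a,b[), and (u_k')^a → (u')^a pointwise L¹-a.e. in ]a,b[. -/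

import Mathlib

open MeasureTheory Filter Set Topology
open scoped ENNReal NNReal

noncomputable section

/-- `Ψ₁(t) = ∫_{-∞}^t ψ(s) ds`. -/
def Psi1 (ψ : ℝ → ℝ) (t : ℝ) : ℝ := ∫ s in Set.Iic t, ψ s

/-- `Ψ_p(t) = ∫_{-∞}^t ψ(s)^{1/p} ds`. -/
def Psip (ψ : ℝ → ℝ) (p t : ℝ) : ℝ := ∫ s in Set.Iic t, ψ s ^ (1 / p)

/-- The natural extension of `Ψ₁` to the extended reals:
`Ψ₁(-∞) = 0`, `Ψ₁(+∞) = ∫_ℝ ψ`. -/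
def Psi1E (ψ : ℝ → ℝ) (t : EReal) : ℝ :=
  if t = ⊤ then ∫ s, ψ s else if t = ⊥ then 0 else Psi1 ψ t.toReal

/-- Standing assumptions on `ψ` in the case `p = 1`: a bounded, everywhere positive
Borel function, integrable on `ℝ`, whose infimum on every compact set is positive. -/
structure PsiHyp (ψ : ℝ → ℝ) : Prop where
  measurable : Measurable ψ
  pos : ∀ t, 0 < ψ t
  bounded : ∃ C, ∀ t, ψ t ≤ C
  integrable : MeasureTheory.Integrable ψ
  inf_pos : ∀ K : Set ℝ, IsCompact K → ∃ δ > 0, ∀ t ∈ K, δ ≤ ψ t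

/-- Standing assumptions on `ψ` in the case `p > 1`: as in `PsiHyp` but with
`ψ^{1/p}` integrable on `ℝ`. -/
structure PsiHypP (ψ : ℝ → ℝ) (p : ℝ) : Prop where
  measurable : Measurable ψ
  pos : ∀ t, 0 < ψ t
  bounded : ∃ C, ∀ t, ψ t ≤ C
  integrable : MeasureTheory.Integrable fun t => ψ t ^ (1 / p)
  inf_pos : ∀ K : Set ℝ, IsCompact K → ∃ δ > 0, ∀ t ∈ K, δ ≤ ψ t

/-- `(μp, μn)` is the Jordan decomposition of the distributional derivative of
`u ∈ L¹(]a,b[)`; the existence of such a pair encodes `u ∈ BV(]a,b[)`,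
and `μp + μn` is the total variation measure `|u'|`. -/
def IsDerivMeasures (a b : ℝ) (u : ℝ → ℝ) (μp μn : Measure ℝ) : Prop :=
  MeasureTheory.IntegrableOn u (Set.Ioo a b) ∧
  IsFiniteMeasure μp ∧ IsFiniteMeasure μn ∧ μp ⟂ₘ μn ∧
  μp (Set.Ioo a b)ᶜ = 0 ∧ μn (Set.Ioo a b)ᶜ = 0 ∧
  ∀ φ : ℝ → ℝ, ContDiff ℝ 1 φ → tsupport φ ⊆ Set.Ioo a b →
    ∫ x in Set.Ioo a b, u x * deriv φ x = (∫ x, φ x ∂μn) - ∫ x, φ x ∂μp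

/-- The density `(u')^a` of the absolutely continuous part of the derivative whose
Jordan decomposition is `(μp, μn)`. -/
def uaD (μp μn : Measure ℝ) (x : ℝ) : ℝ :=
  (μp.rnDeriv MeasureTheory.volume x).toReal - (μn.rnDeriv MeasureTheory.volume x).toReal

/-- Left approximate limit `u₋(y) = lim_{ε→0⁺} ε⁻¹ ∫_{y-ε}^y u`. -/
def leftApproxLim (u : ℝ → ℝ) (y : ℝ) : ℝ :=
  limUnder (𝓝[>] (0 : ℝ)) fun ε => (∫ x in Set.Ioo (y - ε) y, u x) / ε

/-- Right approximate limit `u₊(y) = lim_{ε→0⁺} ε⁻¹ ∫_y^{y+ε} u`. -/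
def rightApproxLim (u : ℝ → ℝ) (y : ℝ) : ℝ :=
  limUnder (𝓝[>] (0 : ℝ)) fun ε => (∫ x in Set.Ioo y (y + ε), u x) / ε

/-- Left approximate limit computed in the extended reals (may be `±∞`). -/
def leftApproxLimE (u : ℝ → ℝ) (y : ℝ) : EReal :=
  limUnder (𝓝[>] (0 : ℝ)) fun ε => (((∫ x in Set.Ioo (y - ε) y, u x) / ε : ℝ) : EReal)

/-- Right approximate limit computed in the extended reals (may be `±∞`). -/
def rightApproxLimE (u : ℝ → ℝ) (y : ℝ) : EReal :=
  limUnder (𝓝[>] (0 : ℝ)) fun ε => (((∫ x in Set.Ioo y (y + ε), u x) / ε : ℝ) : EReal)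

/-- The jump set `S_u` of `u` in `]a,b[`. -/
def jumpSet (a b : ℝ) (u : ℝ → ℝ) : Set ℝ :=
  {y | y ∈ Set.Ioo a b ∧ leftApproxLim u y ≠ rightApproxLim u y}

/-- `ν_u = sign(u₊ - u₋)`. -/
def jumpSign (u : ℝ → ℝ) (y : ℝ) : ℝ :=
  Real.sign (rightApproxLim u y - leftApproxLim u y)

/-- `Z⁺[w] = {x ∈ ]a,b[ : lim_{ε→0⁺} (2ε)⁻¹∫_{x-ε}^{x+ε} w = +∞}`. -/
def ZPlus (a b : ℝ) (w : ℝ → ℝ) : Set ℝ :=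
  {x | x ∈ Set.Ioo a b ∧
    Tendsto (fun ε => (∫ t in Set.Ioo (x - ε) (x + ε), w t) / (2 * ε)) (𝓝[>] (0 : ℝ)) atTop}

/-- `Z⁻[w] = {x ∈ ]a,b[ : lim_{ε→0⁺} (2ε)⁻¹∫_{x-ε}^{x+ε} w = -∞}`. -/
def ZMinus (a b : ℝ) (w : ℝ → ℝ) : Set ℝ :=
  {x | x ∈ Set.Ioo a b ∧
    Tendsto (fun ε => (∫ t in Set.Ioo (x - ε) (x + ε), w t) / (2 * ε)) (𝓝[>] (0 : ℝ)) atBot}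

/-- The positive part `((u')^c)⁺` of the Cantor part of the derivative of `u`:
the singular part of `μp` with the atoms on the jump set removed. -/
def cantorPos (a b : ℝ) (u : ℝ → ℝ) (μp : Measure ℝ) : Measure ℝ :=
  (μp.singularPart MeasureTheory.volume).restrict (jumpSet a b u)ᶜ

/-- The negative part `((u')^c)⁻` of the Cantor part of the derivative of `u`. -/
def cantorNeg (a b : ℝ) (u : ℝ → ℝ) (μn : Measure ℝ) : Measure ℝ :=
  (μn.singularPart MeasureTheory.volume).restrict (jumpSet a b u)ᶜ

/-- `u ∈ X¹_ψ(]a,b[)`, with derivative data `(μp, μn)`:  `u ∈ BV(]a,b[)`,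
`Ψ₁∘(u')^a ∈ BV(]a,b[)`, and `((u')^c)^±` is concentrated on `Z^±[(u')^a]`. -/
def MemX1 (ψ : ℝ → ℝ) (a b : ℝ) (u : ℝ → ℝ) (μp μn : Measure ℝ) : Prop :=
  IsDerivMeasures a b u μp μn ∧
  (∃ νp νn : Measure ℝ, IsDerivMeasures a b (fun x => Psi1 ψ (uaD μp μn x)) νp νn) ∧
  cantorPos a b u μp (ZPlus a b (uaD μp μn))ᶜ = 0 ∧
  cantorNeg a b u μn (ZMinus a b (uaD μp μn))ᶜ = 0

/-- `f ∈ W^{1,p}(]a,b[)`: `f` has an absolutely continuous representative whose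
pointwise a.e. derivative lies in `L^p(]a,b[)`. -/
def MemW1pOn (p a b : ℝ) (f : ℝ → ℝ) : Prop :=
  ∃ g w : ℝ → ℝ,
    (∀ᵐ x ∂(MeasureTheory.volume.restrict (Set.Ioo a b)), g x = f x) ∧
    MeasureTheory.IntegrableOn w (Set.Ioo a b) ∧
    MeasureTheory.IntegrableOn (fun x => |w x| ^ p) (Set.Ioo a b) ∧
    ∀ x ∈ Set.Ioo a b, ∀ y ∈ Set.Ioo a b, g y - g x = ∫ t in x..y, w t

/-- `u ∈ X^p_ψ(]a,b[)`, with derivative data `(μp, μn)`:  `u ∈ BV(]a,b[)`,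
`Ψ_p∘(u')^a ∈ W^{1,p}(]a,b[)`, and `((u')^s)^±` is concentrated on `Z^±[(u')^a]`. -/
def MemXp (ψ : ℝ → ℝ) (p a b : ℝ) (u : ℝ → ℝ) (μp μn : Measure ℝ) : Prop :=
  IsDerivMeasures a b u μp μn ∧
  MemW1pOn p a b (fun x => Psip ψ p (uaD μp μn x)) ∧
  (μp.singularPart MeasureTheory.volume) (ZPlus a b (uaD μp μn))ᶜ = 0 ∧
  (μn.singularPart MeasureTheory.volume) (ZMinus a b (uaD μp μn))ᶜ = 0

/-- `u ∈ W^{2,p}(]a,b[)` with first derivative `v` and second derivative `w`. -/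
def W2pRep (p a b : ℝ) (u v w : ℝ → ℝ) : Prop :=
  (∀ x ∈ Set.Ioo a b, HasDerivAt u (v x) x) ∧
  (∀ x ∈ Set.Ioo a b, ∀ y ∈ Set.Ioo a b, v y - v x = ∫ t in x..y, w t) ∧
  MeasureTheory.IntegrableOn u (Set.Ioo a b) ∧
  MeasureTheory.IntegrableOn v (Set.Ioo a b) ∧
  MeasureTheory.IntegrableOn w (Set.Ioo a b) ∧
  MeasureTheory.IntegrableOn (fun x => |w x| ^ p) (Set.Ioo a b)

/-- The functional `F_p(u) = ∫_a^b |u'| + ∫_a^b ψ(u')|u''|^p` if `u ∈ W^{2,p}(]a,b[)`,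
`+∞` otherwise (as an infimum over Sobolev representations). -/
def Fp (ψ : ℝ → ℝ) (p a b : ℝ) (u : ℝ → ℝ) : ℝ≥0∞ :=
  ⨅ (v : ℝ → ℝ) (w : ℝ → ℝ) (_ : W2pRep p a b u v w),
    ENNReal.ofReal ((∫ x in Set.Ioo a b, |v x|) + ∫ x in Set.Ioo a b, ψ (v x) * |w x| ^ p)

/-- Strong `L¹(]a,b[)` convergence of a sequence. -/
def TendstoL1 (a b : ℝ) (U : ℕ → ℝ → ℝ) (u : ℝ → ℝ) : Prop :=
  (∀ k, MeasureTheory.IntegrableOn (U k) (Set.Ioo a b)) ∧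
  MeasureTheory.IntegrableOn u (Set.Ioo a b) ∧
  Tendsto (fun k => ∫ x in Set.Ioo a b, |U k x - u x|) atTop (𝓝 0)

/-- The relaxed functional
`F̄_p(u) = inf { liminf_k F_p(u_k) : u_k → u in L¹(]a,b[) }`. -/
def FpRel (ψ : ℝ → ℝ) (p a b : ℝ) (u : ℝ → ℝ) : ℝ≥0∞ :=
  ⨅ (U : ℕ → ℝ → ℝ) (_ : TendstoL1 a b U u),
    liminf (fun k => Fp ψ p a b (U k)) atTop

/-- `Φ(s, t₁, t₂)` of the relaxation formula (`s` being the sign of the jump). -/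
def Phi (ψ : ℝ → ℝ) (s : ℝ) (t₁ t₂ : EReal) : ℝ :=
  if 0 < s then ((∫ t, ψ t) - Psi1E ψ t₁) + ((∫ t, ψ t) - Psi1E ψ t₂)
  else Psi1E ψ t₁ + Psi1E ψ t₂

/-- `Φ̂(s, t₁, t₂)` of Remark 2.5. -/
def PhiHat (ψ : ℝ → ℝ) (s : ℝ) (t₁ t₂ : EReal) : ℝ :=
  if 0 < s then (∫ t, ψ t) - Psi1E ψ (max t₁ t₂)
  else Psi1E ψ (min t₁ t₂)

/-- `ubar` is a `C¹([a,b])` representative of `u`. -/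
def C1Rep (a b : ℝ) (u ubar : ℝ → ℝ) : Prop :=
  (∀ᵐ x ∂(MeasureTheory.volume.restrict (Set.Ioo a b)), ubar x = u x) ∧
  ContDiffOn ℝ 1 ubar (Set.Icc a b)

/-- `u` solves `min { F̄₁(w) + λ ∫_a^b (w - G)² : w ∈ X¹_ψ(]a,b[) }`. -/
def IsSolution1 (ψ : ℝ → ℝ) (a b lam : ℝ) (G u : ℝ → ℝ) : Prop :=
  (∃ μp μn : Measure ℝ, MemX1 ψ a b u μp μn) ∧
  ∀ w : ℝ → ℝ, (∃ ηp ηn : Measure ℝ, MemX1 ψ a b w ηp ηn) →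
    FpRel ψ 1 a b u + ENNReal.ofReal (lam * ∫ x in Set.Ioo a b, (u x - G x) ^ 2) ≤
    FpRel ψ 1 a b w + ENNReal.ofReal (lam * ∫ x in Set.Ioo a b, (w x - G x) ^ 2)

/-- `u` solves `min { F̄_p(w) + λ ∫_a^b |w - G|² : w ∈ X^p_ψ(]a,b[) }`. -/
def IsSolutionP (ψ : ℝ → ℝ) (p a b lam : ℝ) (G u : ℝ → ℝ) : Prop :=
  (∃ μp μn : Measure ℝ, MemXp ψ p a b u μp μn) ∧
  ∀ w : ℝ → ℝ, (∃ ηp ηn : Measure ℝ, MemXp ψ p a b w ηp ηn) →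
    FpRel ψ p a b u + ENNReal.ofReal (lam * ∫ x in Set.Ioo a b, (u x - G x) ^ 2) ≤
    FpRel ψ p a b w + ENNReal.ofReal (lam * ∫ x in Set.Ioo a b, (w x - G x) ^ 2)

/-- The Rudin–Osher–Fatemi energy `|w'|(]a,b[) + λ∫_a^b (w-g)²`, where `(ηp, ηn)`
is the Jordan decomposition of the derivative of `w`. -/
def ROFenergy (a b lam : ℝ) (g w : ℝ → ℝ) (ηp ηn : Measure ℝ) : ℝ≥0∞ :=
  (ηp + ηn) (Set.Ioo a b) + ENNReal.ofReal (lam * ∫ x in Set.Ioo a b, (w x - g x) ^ 2)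

/-- The left-continuous generalized inverse `g^{-1}(c) = inf {x ∈ [a,b] : g(x) ≥ c}`. -/
def gInv (a b : ℝ) (g : ℝ → ℝ) (c : ℝ) : ℝ :=
  sInf {x | x ∈ Set.Icc a b ∧ c ≤ g x}

end

noncomputable section
open MeasureTheory Filter Set Topology
open scoped ENNReal NNReal

theorem exists_subseq_tendsto_of_countable {D : Set ℝ} (hD : D.Countable) (F : ℕ → ℝ → ℝ) (M : ℝ)
    (hM : ∀ k, ∀ x ∈ D, |F k x| ≤ M) :
    ∃ φ : ℕ → ℕ, StrictMono φ ∧ ∀ x ∈ D, ∃ l, Tendsto (fun k => F (φ k) x) atTop (𝓝 l) := by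
  have : Countable D := hD.to_subtype
  have hK : IsCompact (Set.pi univ fun _ : D => Icc (-M) M) :=
    isCompact_univ_pi fun _ => isCompact_Icc
  obtain ⟨g, -, φ, hφ, hg⟩ := hK.tendsto_subseq (x := fun k (d : D) => F k d)
    fun k d _ => abs_le.1 (hM k d d.2)
  exact ⟨φ, hφ, fun x hx => ⟨g ⟨x, hx⟩, tendsto_pi_nhds.1 hg ⟨x, hx⟩⟩⟩

theorem helly_selection (T : ℕ → ℝ → ℝ) (hT : ∀ k, Monotone (T k)) (M : ℝ)
    (hM : ∀ k x, |T k x| ≤ M) :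
    ∃ φ : ℕ → ℕ, StrictMono φ ∧ ∃ G : ℝ → ℝ, Monotone G ∧
      ∀ x, Tendsto (fun k => T (φ k) x) atTop (𝓝 (G x)) := by
  obtain ⟨φ, hφ, h1⟩ := exists_subseq_tendsto_of_countable
    (countable_range ((↑) : ℚ → ℝ)) T M fun k x _ => hM k x
  have hbb : ∀ x, IsBoundedUnder (· ≥ ·) atTop fun k => T (φ k) x := fun x =>
    isBoundedUnder_of ⟨-M, fun k => (abs_le.1 (hM _ x)).1⟩
  have hba : ∀ x, IsBoundedUnder (· ≤ ·) atTop fun k => T (φ k) x := fun x =>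
    isBoundedUnder_of ⟨M, fun k => (abs_le.1 (hM _ x)).2⟩
  set G₁ : ℝ → ℝ := fun x => liminf (fun k => T (φ k) x) atTop with hG₁
  have hmono : Monotone G₁ := fun x y hxy =>
    liminf_le_liminf (Eventually.of_forall fun k => hT _ hxy) (hbb x) (hba y).isCoboundedUnder_ge
  have hlim : ∀ q : ℚ, Tendsto (fun k => T (φ k) q) atTop (𝓝 (G₁ q)) := by
    intro q
    obtain ⟨l, hl⟩ := h1 q ⟨q, rfl⟩
    have : G₁ q = l := hl.liminf_eq
    rwa [this]
  have hcont : ∀ x, ContinuousAt G₁ x → Tendsto (fun k => T (φ k) x) atTop (𝓝 (G₁ x)) := by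
    intro x hx
    rw [tendsto_order]
    constructor
    · intro c hc
      obtain ⟨l, hl, hl'⟩ := exists_Ioc_subset_of_mem_nhds (hx.eventually (lt_mem_nhds hc)) ⟨x - 1, by simp⟩
      obtain ⟨q, hq1, hq2⟩ := exists_rat_btwn hl
      have := hl' ⟨hq1, hq2.le⟩
      filter_upwards [(hlim q).eventually (lt_mem_nhds this)] with k hk
      exact hk.trans_le (hT _ hq2.le)
    · intro c hc
      obtain ⟨l, hl, hl'⟩ := exists_Ico_subset_of_mem_nhds (hx.eventually (gt_mem_nhds hc)) ⟨x + 1, by simp⟩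
      obtain ⟨q, hq1, hq2⟩ := exists_rat_btwn hl
      have := hl' ⟨hq1.le, hq2⟩
      filter_upwards [(hlim q).eventually (gt_mem_nhds this)] with k hk
      exact (hT _ hq1.le).trans_lt hk
  obtain ⟨φ₂, hφ₂, h2⟩ := exists_subseq_tendsto_of_countable hmono.countable_not_continuousAt
    (fun k => T (φ k)) M fun k x _ => hM _ x
  have hall : ∀ x, ∃ l, Tendsto (fun k => T (φ (φ₂ k)) x) atTop (𝓝 l) := by
    intro x
    by_cases hx : ContinuousAt G₁ x
    · exact ⟨_, (hcont x hx).comp hφ₂.tendsto_atTop⟩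
    · exact h2 x hx
  choose G hG using hall
  exact ⟨φ ∘ φ₂, hφ.comp hφ₂, G,
    fun x y hxy => le_of_tendsto_of_tendsto' (hG x) (hG y) fun k => hT _ hxy, hG⟩

/-- Helly's selection principle for functions of bounded variation on an open interval, where the
variation of `f k` is dominated by the increments of a monotone function `T k`. -/
theorem helly_selection_bv {a b : ℝ} (f T : ℕ → ℝ → ℝ) (hT : ∀ k, Monotone (T k)) (M : ℝ)
    (hM : ∀ k x, |T k x| ≤ M) (hf : ∀ k, ∀ x ∈ Ioo a b, |f k x| ≤ M)
    (hfT : ∀ k, ∀ x ∈ Ioo a b, ∀ y ∈ Ioo a b, x ≤ y → |f k y - f k x| ≤ T k y - T k x) :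
    ∃ φ : ℕ → ℕ, StrictMono φ ∧ ∃ g G : ℝ → ℝ, Monotone G ∧
      (∀ x, Tendsto (fun k => T (φ k) x) atTop (𝓝 (G x))) ∧
      ∀ x ∈ Ioo a b, Tendsto (fun k => f (φ k) x) atTop (𝓝 (g x)) := by
  obtain ⟨φ, hφ, G, hG, hlim⟩ := helly_selection T hT M hM
  obtain ⟨φ₂, hφ₂, h2⟩ := exists_subseq_tendsto_of_countable
    (((countable_range ((↑) : ℚ → ℝ)).union hG.countable_not_continuousAt).mono
      (inter_subset_left (t := Ioo a b))) (fun k => f (φ k)) M fun k x hx => hf _ x hx.2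
  have hlim2 : ∀ x, Tendsto (fun k => T (φ (φ₂ k)) x) atTop (𝓝 (G x)) := fun x =>
    (hlim x).comp hφ₂.tendsto_atTop
  have hall : ∀ x ∈ Ioo a b, ∃ l, Tendsto (fun k => f (φ (φ₂ k)) x) atTop (𝓝 l) := by
    intro x hx
    by_cases hc : ContinuousAt G x
    · apply cauchySeq_tendsto_of_complete
      rw [Metric.cauchySeq_iff']
      intro ε hε
      have hev : ∀ᶠ y in 𝓝 x, y < b ∧ G y < G x + ε / 4 :=
        (gt_mem_nhds hx.2).and (hc.eventually (gt_mem_nhds (by linarith)))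
      obtain ⟨l, hl, hl'⟩ := exists_Ico_subset_of_mem_nhds hev ⟨x + 1, by simp⟩
      obtain ⟨q, hq1, hq2⟩ := exists_rat_btwn hl
      obtain ⟨hqb, hq⟩ := hl' ⟨hq1.le, hq2⟩
      have hqm : (q : ℝ) ∈ Ioo a b := ⟨hx.1.trans hq1, hqb⟩
      obtain ⟨l, hl⟩ := h2 q ⟨Or.inl ⟨q, rfl⟩, hqm⟩
      have e1 : ∀ᶠ k in atTop, T (φ (φ₂ k)) q - T (φ (φ₂ k)) x < ε / 4 :=
        ((hlim2 q).sub (hlim2 x)).eventually (gt_mem_nhds (by linarith))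
      have e2 := Metric.tendsto_nhds.1 hl (ε / 8) (by linarith)
      obtain ⟨N, hN⟩ := eventually_atTop.1 (e1.and e2)
      refine ⟨N, fun n hn => ?_⟩
      obtain ⟨p1, p2⟩ := hN n hn
      obtain ⟨q1, q2⟩ := hN N le_rfl
      have r1 := abs_le.1 (hfT (φ (φ₂ n)) x hx q hqm hq1.le)
      have r2 := abs_le.1 (hfT (φ (φ₂ N)) x hx q hqm hq1.le)
      rw [Real.dist_eq, abs_lt] at *
      constructor <;> linarith [r1.1, r1.2, r2.1, r2.2, p2.1, p2.2, q2.1, q2.2]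
    · exact h2 x ⟨Or.inr hc, hx⟩
  choose! g hg using hall
  exact ⟨φ ∘ φ₂, hφ.comp hφ₂, g, G, hG, hlim2, hg⟩
/-- If `μ` and `ν` are mutually singular and `μ - ν = α - β`, then `μ ≤ α`. -/
theorem le_of_mutuallySingular_of_add_eq {μ ν α β : Measure ℝ} (h : μ ⟂ₘ ν)
    (heq : μ + β = ν + α) : μ ≤ α := by
  obtain ⟨t, ht, h1, h2⟩ := h
  refine Measure.le_iff.2 fun B _ => ?_
  calc μ B ≤ μ (B \ t) := by
        calc μ B ≤ μ (B ∩ t) + μ (B \ t) := measure_le_inter_add_sdiff _ _ _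
          _ = μ (B \ t) := by rw [measure_mono_null inter_subset_right h1, zero_add]
    _ ≤ (μ + β) (B \ t) := by simp
    _ = ν (B \ t) + α (B \ t) := by rw [heq]; simp
    _ = α (B \ t) := by
        rw [measure_mono_null (fun x hx => hx.2) h2, zero_add]
    _ ≤ α B := measure_mono sdiff_subset

theorem exists_jordan_decomposition (α β : Measure ℝ) [IsFiniteMeasure α] [IsFiniteMeasure β] :
    ∃ μ ν : Measure ℝ, μ ⟂ₘ ν ∧ μ + β = ν + α ∧ μ ≤ α ∧ ν ≤ β := by
  obtain ⟨s, hs, h1, h2⟩ := hahn_decomposition α β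
  have le1 : β.restrict s ≤ α.restrict s := Measure.le_iff.2 fun t ht => by
    rw [Measure.restrict_apply ht, Measure.restrict_apply ht]
    exact h1 _ (ht.inter hs) inter_subset_right
  have le2 : α.restrict sᶜ ≤ β.restrict sᶜ := Measure.le_iff.2 fun t ht => by
    rw [Measure.restrict_apply ht, Measure.restrict_apply ht]
    exact h2 _ (ht.inter hs.compl) inter_subset_right
  have e1 := Measure.sub_add_cancel_of_le le1
  have e2 := Measure.sub_add_cancel_of_le le2
  have hμ : α.restrict s - β.restrict s ≤ α.restrict s := Measure.sub_le
  have hν : β.restrict sᶜ - α.restrict sᶜ ≤ β.restrict sᶜ := Measure.sub_le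
  refine ⟨α.restrict s - β.restrict s, β.restrict sᶜ - α.restrict sᶜ, ?_, ?_,
    hμ.trans Measure.restrict_le_self, hν.trans Measure.restrict_le_self⟩
  · refine ⟨sᶜ, hs.compl, ?_, ?_⟩
    · refine le_antisymm ((hμ _).trans ?_) zero_le
      rw [Measure.restrict_apply hs.compl]; simp
    · refine le_antisymm ((hν _).trans ?_) zero_le
      rw [compl_compl, Measure.restrict_apply hs]; simp
  · calc α.restrict s - β.restrict s + β
        = α.restrict s - β.restrict s + β.restrict s + β.restrict sᶜ := by
          rw [add_assoc, Measure.restrict_add_restrict_compl hs]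
      _ = α.restrict s + (β.restrict sᶜ - α.restrict sᶜ + α.restrict sᶜ) := by rw [e1, e2]
      _ = β.restrict sᶜ - α.restrict sᶜ + (α.restrict s + α.restrict sᶜ) := by
          rw [add_left_comm]
      _ = _ := by rw [Measure.restrict_add_restrict_compl hs]

/-- `f` is represented on `]a,b[` as a constant plus the distribution function of `μ - ν`. -/
def HasDistribRepr (a b : ℝ) (f : ℝ → ℝ) (μ ν : Measure ℝ) (c : ℝ) : Prop :=
  ∀ᵐ x ∂volume.restrict (Ioo a b), f x = c + μ.real (Ioc a x) - ν.real (Ioc a x)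

theorem exists_distrib_of_monotoneOn {a b : ℝ} (hab : a < b) {p : ℝ → ℝ} {M : ℝ}
    (hp : MonotoneOn p (Ioo a b)) (hM : ∀ x ∈ Ioo a b, |p x| ≤ M) :
    ∃ (α : Measure ℝ) (c : ℝ), α (Ioo a b)ᶜ = 0 ∧ α univ ≤ ENNReal.ofReal (2 * M) ∧
      ∀ᵐ x ∂volume.restrict (Ioo a b), p x = c + α.real (Ioc a x) := by
  have hM0 : 0 ≤ M := (abs_nonneg _).trans (hM ((a + b) / 2) ⟨by linarith, by linarith⟩)
  obtain ⟨P₀, hP₀, heq₀⟩ := hp.exists_monotone_extension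
    ⟨-M, by rintro _ ⟨x, hx, rfl⟩; exact (abs_le.1 (hM x hx)).1⟩
    ⟨M, by rintro _ ⟨x, hx, rfl⟩; exact (abs_le.1 (hM x hx)).2⟩
  set P : ℝ → ℝ := fun x => max (-M) (min (P₀ x) M) with hPdef
  have hP : Monotone P := fun x y hxy => max_le_max le_rfl (min_le_min (hP₀ hxy) le_rfl)
  have hPb : ∀ x, -M ≤ P x ∧ P x ≤ M := fun x =>
    ⟨le_max_left _ _, max_le (by linarith) (min_le_right _ _)⟩
  have heq : ∀ x ∈ Ioo a b, P x = p x := fun x hx => by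
    have := abs_le.1 (hM x hx)
    simp only [hPdef]
    rw [← heq₀ hx, min_eq_left this.2, max_eq_right this.1]
  set S := hP.stieltjesFunction with hS
  have hSb : ∀ x, -M ≤ S x ∧ S x ≤ M := fun x => by
    rw [hS, hP.stieltjesFunction_eq]
    exact ⟨(hPb x).1.trans (hP.le_rightLim le_rfl), (hP.rightLim_le (lt_add_one x)).trans (hPb _).2⟩
  refine ⟨S.measure.restrict (Ioo a b), S a, ?_, ?_, ?_⟩
  · rw [Measure.restrict_apply measurableSet_Ioo.compl]; simp
  · rw [Measure.restrict_apply_univ]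
    refine (measure_mono Ioo_subset_Ioc_self).trans ?_
    rw [S.measure_Ioc]
    exact ENNReal.ofReal_le_ofReal (by linarith [(hSb a).1, (hSb b).2])
  · have hc : ∀ᵐ x ∂volume.restrict (Ioo a b), ContinuousAt P x :=
      ae_restrict_of_ae (by
        have := hP.countable_not_continuousAt.measure_zero volume
        exact this)
    filter_upwards [hc, ae_restrict_mem measurableSet_Ioo] with x hx hxm
    have h1 : S x = p x := by
      rw [hS, hP.stieltjesFunction_eq, ← heq x hxm]
      exact rightLim_eq_of_tendsto (hx.tendsto.mono_left nhdsWithin_le_nhds)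
    have h2 : Ioc a x ∩ Ioo a b = Ioc a x :=
      inter_eq_left.2 fun y hy => ⟨hy.1, hy.2.trans_lt hxm.2⟩
    rw [Measure.real, Measure.restrict_apply measurableSet_Ioc, h2, S.measure_Ioc,
      ENNReal.toReal_ofReal (sub_nonneg.2 (S.mono hxm.1.le)), h1]
    ring

theorem exists_distrib_repr {a b : ℝ} (hab : a < b) {f T : ℝ → ℝ} {M : ℝ}
    (hM : ∀ x ∈ Ioo a b, |T x| ≤ M) (hf : ∀ x ∈ Ioo a b, |f x| ≤ M)
    (hfT : ∀ x ∈ Ioo a b, ∀ y ∈ Ioo a b, x ≤ y → |f y - f x| ≤ T y - T x) :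
    ∃ (μ ν : Measure ℝ) (c : ℝ), μ ⟂ₘ ν ∧ μ (Ioo a b)ᶜ = 0 ∧ ν (Ioo a b)ᶜ = 0 ∧
      μ univ ≤ ENNReal.ofReal (2 * M) ∧ ν univ ≤ ENNReal.ofReal (2 * M) ∧
      HasDistribRepr a b f μ ν c := by
  obtain ⟨α, c₁, hα, hαM, hα1⟩ := exists_distrib_of_monotoneOn hab (M := M)
    (p := fun x => (T x + f x) / 2)
    (fun x hx y hy hxy => by
      have := abs_le.1 (hfT x hx y hy hxy); dsimp only; linarith [this.1])
    (fun x hx => by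
      have h1 := abs_le.1 (hM x hx); have h2 := abs_le.1 (hf x hx)
      exact abs_le.2 ⟨by linarith [h1.1, h2.1], by linarith [h1.2, h2.2]⟩)
  obtain ⟨β, c₂, hβ, hβM, hβ1⟩ := exists_distrib_of_monotoneOn hab (M := M)
    (p := fun x => (T x - f x) / 2)
    (fun x hx y hy hxy => by
      have := abs_le.1 (hfT x hx y hy hxy); dsimp only; linarith [this.2])
    (fun x hx => by
      have h1 := abs_le.1 (hM x hx); have h2 := abs_le.1 (hf x hx)
      exact abs_le.2 ⟨by linarith [h1.1, h2.2], by linarith [h1.2, h2.1]⟩)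
  have : IsFiniteMeasure α := ⟨hαM.trans_lt ENNReal.ofReal_lt_top⟩
  have : IsFiniteMeasure β := ⟨hβM.trans_lt ENNReal.ofReal_lt_top⟩
  obtain ⟨μ, ν, hμν, hadd, hμ, hν⟩ := exists_jordan_decomposition α β
  have : IsFiniteMeasure μ := isFiniteMeasure_of_le α hμ
  have : IsFiniteMeasure ν := isFiniteMeasure_of_le β hν
  refine ⟨μ, ν, c₁ - c₂, hμν, le_antisymm ((hμ _).trans hα.le) zero_le,
    le_antisymm ((hν _).trans hβ.le) zero_le, (hμ _).trans hαM, (hν _).trans hβM, ?_⟩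
  filter_upwards [hα1, hβ1] with x h1 h2
  have h3 : μ.real (Ioc a x) + β.real (Ioc a x) = ν.real (Ioc a x) + α.real (Ioc a x) := by
    rw [← measureReal_add_apply, ← measureReal_add_apply, hadd]
  linarith

theorem integral_distrib_mul_deriv {a b : ℝ} (μ : Measure ℝ) [IsFiniteMeasure μ]
    (hμ : μ (Ioo a b)ᶜ = 0) {φ : ℝ → ℝ} (hφ : ContDiff ℝ 1 φ) (hs : tsupport φ ⊆ Ioo a b) :
    ∫ x in Ioo a b, μ.real (Ioc a x) * deriv φ x = - ∫ x, φ x ∂μ := by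
  have hcd : Continuous (deriv φ) := hφ.continuous_deriv le_rfl
  have hz : ∀ x, x ∉ Ioo a b → φ x = 0 := fun x hx => image_eq_zero_of_notMem_tsupport fun h => hx (hs h)
  have hae : ∀ᵐ t ∂μ, t ∈ Ioo a b := hμ
  have hftc : ∀ t ∈ Ioo a b, ∫ x in Ioo a b, (Ici t).indicator (deriv φ) x = - φ t := by
    intro t ht
    rw [setIntegral_indicator measurableSet_Ici]
    have : Ioo a b ∩ Ici t = Ico t b := by
      ext x; simp only [mem_inter_iff, mem_Ioo, mem_Ici, mem_Ico]
      exact ⟨fun h => ⟨h.2, h.1.2⟩, fun h => ⟨⟨ht.1.trans_le h.1, h.2⟩, h.1⟩⟩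
    rw [this, integral_Ico_eq_integral_Ioc, ← intervalIntegral.integral_of_le ht.2.le,
      intervalIntegral.integral_deriv_eq_sub (fun x _ => hφ.differentiable one_ne_zero x)
        (hcd.intervalIntegrable _ _), hz b (by simp)]
    ring
  obtain ⟨C, hC⟩ := isCompact_Icc.exists_bound_of_continuousOn (hcd.continuousOn (s := Icc a b))
  have hint : Integrable (Function.uncurry fun x t => (Ici t).indicator (deriv φ) x)
      ((volume.restrict (Ioo a b)).prod μ) := by
    have hm : MeasurableSet {p : ℝ × ℝ | p.2 ≤ p.1} := measurableSet_le measurable_snd measurable_fst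
    have : (Function.uncurry fun x t => (Ici t).indicator (deriv φ) x) =
        {p : ℝ × ℝ | p.2 ≤ p.1}.indicator (fun p => deriv φ p.1) := by
      ext ⟨x, t⟩; simp [indicator]
    rw [this]
    refine Integrable.indicator ?_ hm
    exact Integrable.comp_fst (f := deriv φ) (μ := volume.restrict (Ioo a b))
      ((hcd.integrableOn_Icc).mono_set Ioo_subset_Icc_self) μ
  calc ∫ x in Ioo a b, μ.real (Ioc a x) * deriv φ x
      = ∫ x in Ioo a b, ∫ t, (Ici t).indicator (deriv φ) x ∂μ := by
        refine setIntegral_congr_fun measurableSet_Ioo fun x hx => ?_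
        have : (fun t => (Ici t).indicator (deriv φ) x) =ᵐ[μ]
            (Ioc a x).indicator (fun _ => deriv φ x) := by
          filter_upwards [hae] with t ht
          simp only [indicator, mem_Ici, mem_Ioc, ht.1, true_and]
        rw [integral_congr_ae this, integral_indicator measurableSet_Ioc, setIntegral_const,
          smul_eq_mul]
    _ = ∫ t, (∫ x in Ioo a b, (Ici t).indicator (deriv φ) x) ∂μ := integral_integral_swap hint
    _ = ∫ t, - φ t ∂μ := by
        refine integral_congr_ae ?_
        filter_upwards [hae] with t ht using hftc t ht
    _ = _ := integral_neg _

theorem integrableOn_distrib {a b : ℝ} (μ : Measure ℝ) [IsFiniteMeasure μ] :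
    IntegrableOn (fun x => μ.real (Ioc a x)) (Ioo a b) := by
  have hm : Monotone fun x => μ.real (Ioc a x) := fun x y hxy =>
    measureReal_mono (Ioc_subset_Ioc_right hxy)
  exact Measure.integrableOn_of_bounded (M := μ.real univ) (by simp)
    hm.measurable.aestronglyMeasurable (Eventually.of_forall fun x => by
      rw [Real.norm_of_nonneg measureReal_nonneg]; exact measureReal_mono (subset_univ _))

theorem HasDistribRepr.isDerivMeasures {a b : ℝ} (hab : a < b) {f : ℝ → ℝ} {μ ν : Measure ℝ}
    [IsFiniteMeasure μ] [IsFiniteMeasure ν] {c : ℝ} (h : HasDistribRepr a b f μ ν c)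
    (hμν : μ ⟂ₘ ν) (hμ : μ (Ioo a b)ᶜ = 0) (hν : ν (Ioo a b)ᶜ = 0) :
    IsDerivMeasures a b f μ ν := by
  have i1 := integrableOn_distrib (a := a) (b := b) μ
  have i2 := integrableOn_distrib (a := a) (b := b) ν
  have i0 : IntegrableOn (fun _ : ℝ => c) (Ioo a b) := integrableOn_const (by simp)
  refine ⟨((i0.add i1).sub i2).congr (h.mono fun x hx => hx.symm), inferInstance, inferInstance,
    hμν, hμ, hν, fun φ hφ hs => ?_⟩
  have hcd : Continuous (deriv φ) := hφ.continuous_deriv le_rfl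
  obtain ⟨C, hC⟩ := isCompact_Icc.exists_bound_of_continuousOn (hcd.continuousOn (s := Icc a b))
  have hb : ∀ᵐ x ∂volume.restrict (Ioo a b), ‖deriv φ x‖ ≤ C :=
    (ae_restrict_mem measurableSet_Ioo).mono fun x hx => hC x (Ioo_subset_Icc_self hx)
  have j0 := i0.mul_bdd hcd.aestronglyMeasurable hb
  have j1 := i1.mul_bdd hcd.aestronglyMeasurable hb
  have j2 := i2.mul_bdd hcd.aestronglyMeasurable hb
  have hz : ∀ x, x ∉ Ioo a b → φ x = 0 := fun x hx => image_eq_zero_of_notMem_tsupport fun h => hx (hs h)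
  have hc0 : ∫ x in Ioo a b, c * deriv φ x = 0 := by
    rw [integral_const_mul, ← integral_Ioc_eq_integral_Ioo, ← intervalIntegral.integral_of_le hab.le,
      intervalIntegral.integral_deriv_eq_sub (fun x _ => hφ.differentiable one_ne_zero x)
        (hcd.intervalIntegrable _ _), hz b (by simp), hz a (by simp)]
    simp
  calc ∫ x in Ioo a b, f x * deriv φ x
      = ∫ x in Ioo a b, (c * deriv φ x + μ.real (Ioc a x) * deriv φ x
          - ν.real (Ioc a x) * deriv φ x) := by
        refine integral_congr_ae (h.mono fun x hx => ?_)
        dsimp only; rw [hx]; ring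
    _ = _ := by
        have := integral_sub (j0.add j1) j2
        simp only [Pi.add_apply] at this
        rw [this, integral_add j0 j1, hc0, integral_distrib_mul_deriv μ hμ hφ hs,
          integral_distrib_mul_deriv ν hν hφ hs]
        ring
theorem tendsto_setIntegral_div_of_ae_close {f : ℝ → ℝ} {l : ℝ} {I : ℝ → Set ℝ}
    (hvol : ∀ ε > 0, volume (I ε) = ENNReal.ofReal ε)
    (hint : ∀ᶠ ε in 𝓝[>] (0 : ℝ), IntegrableOn f (I ε))
    (hcl : ∀ δ > 0, ∀ᶠ ε in 𝓝[>] (0 : ℝ), ∀ᵐ x ∂volume.restrict (I ε), |f x - l| ≤ δ) :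
    Tendsto (fun ε => (∫ x in I ε, f x) / ε) (𝓝[>] 0) (𝓝 l) := by
  rw [Metric.tendsto_nhds]
  intro δ hδ
  filter_upwards [hint, hcl (δ / 2) (by linarith), self_mem_nhdsWithin] with ε hi hc hε
  have hε' : (0 : ℝ) < ε := hε
  have hv : volume.real (I ε) = ε := by
    rw [Measure.real, hvol ε hε', ENNReal.toReal_ofReal hε'.le]
  have hfin : volume (I ε) < ∞ := by rw [hvol ε hε']; exact ENNReal.ofReal_lt_top
  have h1 := norm_setIntegral_le_of_norm_le_const_ae hfin (f := fun x => f x - l) hc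
  rw [integral_sub hi (integrableOn_const hfin.ne), setIntegral_const, hv, smul_eq_mul,
    Real.norm_eq_abs] at h1
  rw [Real.dist_eq]
  have : (∫ x in I ε, f x) / ε - l = ((∫ x in I ε, f x) - ε * l) / ε := by field_simp
  rw [this, abs_div, abs_of_pos hε', div_lt_iff₀ hε']
  nlinarith

theorem tendsto_measureReal_Ioc_left (μ : Measure ℝ) [IsFiniteMeasure μ] (a y : ℝ) :
    Tendsto (fun x => μ.real (Ioc a x)) (𝓝[<] y) (𝓝 (μ.real (Ioo a y))) := by
  refine (ENNReal.tendsto_toReal (measure_ne_top _ _)).comp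
    (tendsto_measure_of_tendsto_indicator_of_isFiniteMeasure _ μ (fun _ => measurableSet_Ioc) ?_)
  intro t
  by_cases ht : t < y
  · filter_upwards [Ioo_mem_nhdsLT ht] with x hx
    simp only [mem_Ioc, mem_Ioo, ht, hx.1.le]
  · filter_upwards [self_mem_nhdsWithin] with x hx
    simp only [mem_Ioc, mem_Ioo, ht, and_false, iff_false, not_and, not_le]
    exact fun _ => lt_of_lt_of_le hx (not_lt.1 ht)

theorem tendsto_measureReal_Ioc_right (μ : Measure ℝ) [IsFiniteMeasure μ] (a y : ℝ) :
    Tendsto (fun x => μ.real (Ioc a x)) (𝓝[>] y) (𝓝 (μ.real (Ioc a y))) := by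
  refine (ENNReal.tendsto_toReal (measure_ne_top _ _)).comp
    (tendsto_measure_of_tendsto_indicator_of_isFiniteMeasure _ μ (fun _ => measurableSet_Ioc) ?_)
  intro t
  by_cases ht : t ≤ y
  · filter_upwards [self_mem_nhdsWithin] with x hx
    simp only [mem_Ioc, ht, ht.trans (le_of_lt hx)]
  · filter_upwards [Ioo_mem_nhdsGT (not_le.1 ht)] with x hx
    simp only [mem_Ioc, ht, not_le.2 hx.2]

section jumps

variable {a b c : ℝ} {f : ℝ → ℝ} {μ ν : Measure ℝ} [IsFiniteMeasure μ] [IsFiniteMeasure ν]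

theorem HasDistribRepr.leftApproxLim_eq (h : HasDistribRepr a b f μ ν c)
    (hf : IntegrableOn f (Ioo a b)) {y : ℝ} (hy : y ∈ Ioo a b) :
    leftApproxLim f y = c + μ.real (Ioo a y) - ν.real (Ioo a y) := by
  refine Tendsto.limUnder_eq (tendsto_setIntegral_div_of_ae_close
    (I := fun ε => Ioo (y - ε) y) (fun ε hε => by simp) ?_ ?_)
  · filter_upwards [Ioo_mem_nhdsGT (sub_pos.2 hy.1)] with ε hε
    exact hf.mono_set (Ioo_subset_Ioo (by linarith [hε.2]) hy.2.le)
  · intro δ hδ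
    have ht := (((tendsto_measureReal_Ioc_left μ a y).const_add c).sub
      (tendsto_measureReal_Ioc_left ν a y))
    obtain ⟨r, hr, hr'⟩ := mem_nhdsLT_iff_exists_Ioo_subset.1
      (Metric.tendsto_nhds.1 ht δ hδ)
    have hr : r < y := hr
    filter_upwards [Ioo_mem_nhdsGT (sub_pos.2 hy.1), Ioo_mem_nhdsGT (sub_pos.2 hr)] with ε h1 h2
    filter_upwards [ae_restrict_of_ae_restrict_of_subset
      (Ioo_subset_Ioo (by linarith [h1.2]) hy.2.le : Ioo (y - ε) y ⊆ Ioo a b) h,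
      ae_restrict_mem measurableSet_Ioo] with x hx hxm
    rw [hx]
    exact (hr' ⟨by linarith [h2.2, hxm.1], hxm.2⟩ : dist _ _ < δ).le

theorem HasDistribRepr.rightApproxLim_eq (h : HasDistribRepr a b f μ ν c)
    (hf : IntegrableOn f (Ioo a b)) {y : ℝ} (hy : y ∈ Ioo a b) :
    rightApproxLim f y = c + μ.real (Ioc a y) - ν.real (Ioc a y) := by
  refine Tendsto.limUnder_eq (tendsto_setIntegral_div_of_ae_close
    (I := fun ε => Ioo y (y + ε)) (fun ε hε => by simp) ?_ ?_)
  · filter_upwards [Ioo_mem_nhdsGT (sub_pos.2 hy.2)] with ε hε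
    exact hf.mono_set (Ioo_subset_Ioo hy.1.le (by linarith [hε.2]))
  · intro δ hδ
    have ht := (((tendsto_measureReal_Ioc_right μ a y).const_add c).sub
      (tendsto_measureReal_Ioc_right ν a y))
    obtain ⟨r, hr, hr'⟩ := mem_nhdsGT_iff_exists_Ioo_subset.1
      (Metric.tendsto_nhds.1 ht δ hδ)
    have hr : y < r := hr
    filter_upwards [Ioo_mem_nhdsGT (sub_pos.2 hy.2), Ioo_mem_nhdsGT (sub_pos.2 hr)] with ε h1 h2
    filter_upwards [ae_restrict_of_ae_restrict_of_subset
      (Ioo_subset_Ioo hy.1.le (by linarith [h1.2]) : Ioo y (y + ε) ⊆ Ioo a b) h,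
      ae_restrict_mem measurableSet_Ioo] with x hx hxm
    rw [hx]
    exact (hr' ⟨hxm.1, by linarith [h2.2, hxm.2]⟩ : dist _ _ < δ).le

theorem HasDistribRepr.mem_jumpSet_iff (h : HasDistribRepr a b f μ ν c)
    (hf : IntegrableOn f (Ioo a b)) {y : ℝ} (hy : y ∈ Ioo a b) :
    y ∈ jumpSet a b f ↔ μ.real {y} ≠ ν.real {y} := by
  have key : ∀ η : Measure ℝ, [IsFiniteMeasure η] →
      η.real (Ioc a y) = η.real (Ioo a y) + η.real {y} := fun η _ => by
    rw [← Ioo_union_right hy.1, measureReal_union (by simp) (measurableSet_singleton y)]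
  simp only [jumpSet, mem_ofPred_eq, hy, true_and, h.leftApproxLim_eq hf hy,
    h.rightApproxLim_eq hf hy, key μ, key ν]
  refine not_congr ⟨fun h => by linarith, fun h => by linarith⟩

theorem HasDistribRepr.countable_jumpSet (h : HasDistribRepr a b f μ ν c)
    (hf : IntegrableOn f (Ioo a b)) : (jumpSet a b f).Countable := by
  have key : ∀ η : Measure ℝ, [IsFiniteMeasure η] → {y | 0 < η {y}}.Countable := fun η _ =>
    Measure.countable_meas_pos_of_disjoint_iUnion (fun y => measurableSet_singleton y)
      fun x y hxy => by simpa using hxy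
  refine ((key μ).union (key ν)).mono fun y hy => ?_
  have h1 := (h.mem_jumpSet_iff hf hy.1).1 hy
  by_contra hn
  simp only [mem_union, mem_ofPred_eq, not_or, not_lt, nonpos_iff_eq_zero] at hn
  simp [Measure.real, hn.1, hn.2] at h1

/-- Off the jump set the derivative has no atoms. -/
theorem HasDistribRepr.measure_singleton_eq_zero (h : HasDistribRepr a b f μ ν c)
    (hf : IntegrableOn f (Ioo a b)) (hμν : μ ⟂ₘ ν) {y : ℝ} (hy : y ∈ Ioo a b)
    (hyj : y ∉ jumpSet a b f) : μ {y} = 0 ∧ ν {y} = 0 := by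
  have heq : μ.real {y} = ν.real {y} := not_not.1 (mt (h.mem_jumpSet_iff hf hy).2 hyj)
  have heq' : μ {y} = ν {y} := (measureReal_eq_measureReal_iff).1 heq
  obtain ⟨t, ht, h1, h2⟩ := hμν
  by_cases hyt : y ∈ t
  · have : μ {y} = 0 := measure_mono_null (by simpa using hyt) h1
    exact ⟨this, heq' ▸ this⟩
  · have : ν {y} = 0 := measure_mono_null (by simpa using hyt) h2
    exact ⟨heq'.trans this, this⟩

end jumps

theorem integral_sub_eq_of_test {a b : ℝ} {α β : Measure ℝ} [IsFiniteMeasure α] [IsFiniteMeasure β]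
    (hα : α (Ioo a b)ᶜ = 0) (hβ : β (Ioo a b)ᶜ = 0)
    (h : ∀ φ : ℝ → ℝ, ContDiff ℝ 1 φ → tsupport φ ⊆ Ioo a b → ∫ x, φ x ∂α = ∫ x, φ x ∂β) :
    α = β := by
  have key : ∀ c d, a ≤ c → d ≤ b → α (Ioo c d) = β (Ioo c d) := by
    intro c d hc hd
    rcases le_or_gt d c with hcd | hcd
    · simp [Ioo_eq_empty (not_lt.2 hcd)]
    set χ : ℕ → ℝ → ℝ := fun n x => Real.smoothTransition (n * ((x - c) * (d - x)) - 1) with hχ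
    have hneg : ∀ x, x ∉ Ioo c d → (x - c) * (d - x) ≤ 0 := by
      intro x hx
      rcases le_or_gt x c with h1 | h1
      · exact mul_nonpos_of_nonpos_of_nonneg (by linarith) (by linarith)
      · have : d ≤ x := by by_contra! h2; exact hx ⟨h1, h2⟩
        exact mul_nonpos_of_nonneg_of_nonpos (by linarith) (by linarith)
    have hsm : ∀ n, ContDiff ℝ 1 (χ n) := fun n =>
      Real.smoothTransition.contDiff.comp (by fun_prop)
    have hts : ∀ n, tsupport (χ n) ⊆ Ioo a b := by
      intro n
      have hcl : IsClosed {x : ℝ | 1 ≤ n * ((x - c) * (d - x))} :=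
        isClosed_le continuous_const (by fun_prop)
      refine (closure_minimal ?_ hcl).trans ?_
      · intro x hx
        by_contra hx'
        simp only [mem_ofPred_eq, not_le] at hx'
        exact hx (Real.smoothTransition.zero_of_nonpos (by linarith))
      · intro x hx
        simp only [mem_ofPred_eq] at hx
        have : x ∈ Ioo c d := by
          by_contra hx'
          have := mul_nonpos_of_nonneg_of_nonpos (Nat.cast_nonneg (α := ℝ) n) (hneg x hx')
          linarith
        exact ⟨hc.trans_lt this.1, this.2.trans_le hd⟩
    have hlim : ∀ x, Tendsto (fun n => χ n x) atTop (𝓝 ((Ioo c d).indicator (fun _ => (1 : ℝ)) x)) := by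
      intro x
      by_cases hx : x ∈ Ioo c d
      · rw [indicator_of_mem hx]
        have hp : 0 < (x - c) * (d - x) := mul_pos (by linarith [hx.1]) (by linarith [hx.2])
        have : Tendsto (fun n : ℕ => (n : ℝ) * ((x - c) * (d - x))) atTop atTop :=
          tendsto_natCast_atTop_atTop.atTop_mul_const hp
        refine tendsto_const_nhds.congr' ?_
        filter_upwards [this.eventually_ge_atTop 2] with n hn
        exact (Real.smoothTransition.one_of_one_le (by linarith)).symm
      · rw [indicator_of_notMem hx]
        refine tendsto_const_nhds.congr fun n => ?_
        have := mul_nonpos_of_nonneg_of_nonpos (Nat.cast_nonneg (α := ℝ) n) (hneg x hx)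
        exact (Real.smoothTransition.zero_of_nonpos (by linarith)).symm
    have hdct : ∀ γ : Measure ℝ, IsFiniteMeasure γ →
        Tendsto (fun n => ∫ x, χ n x ∂γ) atTop (𝓝 (γ.real (Ioo c d))) := by
      intro γ _
      rw [← integral_indicator_one measurableSet_Ioo]
      refine tendsto_integral_of_dominated_convergence (fun _ => 1)
        (fun n => (hsm n).continuous.aestronglyMeasurable) (integrable_const _)
        (fun n => Eventually.of_forall fun x => ?_) (Eventually.of_forall hlim)
      rw [Real.norm_of_nonneg (Real.smoothTransition.nonneg _)]
      exact Real.smoothTransition.le_one _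
    have := tendsto_nhds_unique (hdct α inferInstance)
      ((hdct β inferInstance).congr fun n => (h _ (hsm n) (hts n)).symm)
    exact (measureReal_eq_measureReal_iff).1 this
  refine Real.measure_ext_Ioo_rat fun p q => ?_
  have e : ∀ γ : Measure ℝ, γ (Ioo a b)ᶜ = 0 → γ (Ioo p q) = γ (Ioo (max p a) (min q b)) := by
    intro γ hγ
    rw [← Ioo_inter_Ioo]
    exact (measure_inter_conull hγ).symm
  rw [e α hα, e β hβ]
  exact key _ _ (le_max_right _ _) (min_le_right _ _)

theorem IsDerivMeasures.add_eq_add {a b : ℝ} {f g : ℝ → ℝ} {μ ν μ' ν' : Measure ℝ}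
    (h : IsDerivMeasures a b f μ ν) (h' : IsDerivMeasures a b g μ' ν')
    (hfg : ∀ᵐ x ∂volume.restrict (Ioo a b), f x = g x) : μ + ν' = ν + μ' := by
  obtain ⟨-, i1, i2, -, z1, z2, e⟩ := h
  obtain ⟨-, i3, i4, -, z3, z4, e'⟩ := h'
  refine integral_sub_eq_of_test (a := a) (b := b) (by simp [z1, z4]) (by simp [z2, z3])
    fun φ hφ hs => ?_
  have hc : HasCompactSupport φ :=
    isCompact_Icc.of_isClosed_subset (isClosed_tsupport _) (hs.trans Ioo_subset_Icc_self)
  have hi : ∀ γ : Measure ℝ, IsFiniteMeasure γ → Integrable φ γ := fun γ _ =>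
    hφ.continuous.integrable_of_hasCompactSupport hc
  rw [integral_add_measure (hi μ i1) (hi ν' i4), integral_add_measure (hi ν i2) (hi μ' i3)]
  have e1 := e φ hφ hs
  have e2 := e' φ hφ hs
  have : ∫ x in Ioo a b, f x * deriv φ x = ∫ x in Ioo a b, g x * deriv φ x :=
    integral_congr_ae (hfg.mono fun x hx => by simp only [hx])
  linarith

theorem uaD_ae_eq_of_add_eq_add {μ ν μ' ν' : Measure ℝ} [IsFiniteMeasure μ] [IsFiniteMeasure ν]
    [IsFiniteMeasure μ'] [IsFiniteMeasure ν'] (h : μ + ν' = ν + μ') :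
    ∀ᵐ x, uaD μ ν x = uaD μ' ν' x := by
  have h1 := Measure.rnDeriv_add' μ ν' volume
  have h2 := Measure.rnDeriv_add' ν μ' volume
  rw [h] at h1
  filter_upwards [h1, h2, μ.rnDeriv_lt_top volume, ν.rnDeriv_lt_top volume,
    μ'.rnDeriv_lt_top volume, ν'.rnDeriv_lt_top volume] with x e1 e2 f1 f2 f3 f4
  have := e1.symm.trans e2
  simp only [Pi.add_apply] at this
  have := congrArg ENNReal.toReal this
  rw [ENNReal.toReal_add f1.ne f4.ne, ENNReal.toReal_add f2.ne f3.ne] at this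
  unfold uaD
  linarith

theorem IsDerivMeasures.uaD_ae_eq {a b : ℝ} {f g : ℝ → ℝ} {μ ν μ' ν' : Measure ℝ}
    (h : IsDerivMeasures a b f μ ν) (h' : IsDerivMeasures a b g μ' ν')
    (hfg : ∀ᵐ x ∂volume.restrict (Ioo a b), f x = g x) : ∀ᵐ x, uaD μ ν x = uaD μ' ν' x := by
  have := h.add_eq_add h' hfg
  obtain ⟨-, i1, i2, -⟩ := h
  obtain ⟨-, i3, i4, -⟩ := h'
  exact uaD_ae_eq_of_add_eq_add this

theorem IsDerivMeasures.le_le {a b : ℝ} {f g : ℝ → ℝ} {μ ν μ' ν' : Measure ℝ}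
    (h : IsDerivMeasures a b f μ ν) (h' : IsDerivMeasures a b g μ' ν')
    (hfg : ∀ᵐ x ∂volume.restrict (Ioo a b), f x = g x) : μ ≤ μ' ∧ ν ≤ ν' := by
  have e := h.add_eq_add h' hfg
  have hm := h.2.2.2.1
  exact ⟨le_of_mutuallySingular_of_add_eq hm e, le_of_mutuallySingular_of_add_eq hm.symm e.symm⟩

theorem exists_add_eq_of_forall_Ioc {A B : Measure ℝ} [IsFiniteMeasure A] [IsFiniteMeasure B]
    (h : ∀ s t, s ≤ t → B.real (Ioc s t) ≤ A.real (Ioc s t)) :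
    ∃ C : Measure ℝ, IsFiniteMeasure C ∧ B + C = A := by
  have hdiff : ∀ (γ : Measure ℝ) [IsFiniteMeasure γ] (s t : ℝ), s ≤ t →
      γ.real (Iic t) - γ.real (Iic s) = γ.real (Ioc s t) := by
    intro γ _ s t hst
    rw [← Iic_sdiff_Iic, measureReal_sdiff (Iic_subset_Iic.2 hst) measurableSet_Iic]
  let F : StieltjesFunction ℝ :=
    { toFun := fun x => A.real (Iic x) - B.real (Iic x)
      mono' := fun s t hst => by
        have := h s t hst
        rw [← hdiff A s t hst, ← hdiff B s t hst] at this
        linarith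
      right_continuous' := fun x => by
        rw [← continuousWithinAt_Ioi_iff_Ici]
        have h1 := (tendsto_measureReal_Ioc_right A x x).sub (tendsto_measureReal_Ioc_right B x x)
        have h2 := h1.const_add (A.real (Iic x) - B.real (Iic x))
        simp only [Ioc_self, measureReal_empty, sub_zero, add_zero] at h2
        refine h2.congr' ?_
        filter_upwards [self_mem_nhdsWithin] with y hy
        have hy : x ≤ y := le_of_lt hy
        rw [← hdiff A x y hy, ← hdiff B x y hy]
        ring }
  have hF : ∀ x, F x = A.real (Iic x) - B.real (Iic x) := fun x => rfl
  have hfin : IsFiniteMeasure F.measure := by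
    refine F.isFiniteMeasure_of_forall_abs_le (C := A.real univ + B.real univ) fun x => ?_
    rw [hF]
    have h1 : A.real (Iic x) ≤ A.real univ := measureReal_mono (subset_univ _)
    have h2 : B.real (Iic x) ≤ B.real univ := measureReal_mono (subset_univ _)
    have h3 : 0 ≤ A.real (Iic x) := measureReal_nonneg
    have h4 : 0 ≤ B.real (Iic x) := measureReal_nonneg
    exact abs_le.2 ⟨by linarith, by linarith⟩
  refine ⟨F.measure, hfin, Measure.ext_of_Ioc _ _ fun s t hst => ?_⟩
  rw [Measure.add_apply, F.measure_Ioc, ← ofReal_measureReal, ← ofReal_measureReal (μ := A),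
    ← ENNReal.ofReal_add measureReal_nonneg (sub_nonneg.2 (F.mono hst.le)), hF, hF]
  congr 1
  have h1 := hdiff A s t hst.le
  have h2 := hdiff B s t hst.le
  linarith

theorem measureReal_withDensity_sub {g : ℝ → ℝ} (hg : Integrable g) {s : Set ℝ}
    (hs : MeasurableSet s) :
    (volume.withDensity fun x => ENNReal.ofReal (g x)).real s -
      (volume.withDensity fun x => ENNReal.ofReal (-g x)).real s = ∫ x in s, g x := by
  rw [measureReal_def, measureReal_def, withDensity_apply _ hs, withDensity_apply _ hs,
    integral_eq_lintegral_pos_part_sub_lintegral_neg_part hg.integrableOn]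

theorem uaD_ge_of_integral_le {μ ν : Measure ℝ} [IsFiniteMeasure μ] [IsFiniteMeasure ν]
    (hμν : μ ⟂ₘ ν) {x₁ x₂ : ℝ} {g : ℝ → ℝ} (hg : IntegrableOn g (Ioc x₁ x₂))
    (h : ∀ z z', x₁ ≤ z → z ≤ z' → z' ≤ x₂ →
      ∫ x in Ioc z z', g x ≤ μ.real (Ioc z z') - ν.real (Ioc z z')) :
    (∀ᵐ x ∂volume.restrict (Ioc x₁ x₂), g x ≤ uaD μ ν x) ∧
      ν.singularPart volume (Ioc x₁ x₂) = 0 := by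
  set I := Ioc x₁ x₂ with hI
  have hIm : MeasurableSet I := measurableSet_Ioc
  set g' : ℝ → ℝ := I.indicator g with hg'
  have hg'i : Integrable g' := hg.integrable_indicator hIm
  set D₁ := volume.withDensity fun x => ENNReal.ofReal (g' x) with hD₁
  set D₂ := volume.withDensity fun x => ENNReal.ofReal (-g' x) with hD₂
  have f₁ : IsFiniteMeasure D₁ := isFiniteMeasure_withDensity_ofReal hg'i.2
  have f₂ : IsFiniteMeasure D₂ := isFiniteMeasure_withDensity_ofReal hg'i.neg.2
  obtain ⟨C, hC, hadd⟩ := exists_add_eq_of_forall_Ioc (A := μ.restrict I + D₂)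
    (B := ν.restrict I + D₁) fun s t hst => by
      have e := measureReal_withDensity_sub hg'i (measurableSet_Ioc (a := s) (b := t))
      rw [← hD₁, ← hD₂, setIntegral_indicator hIm] at e
      rw [measureReal_add_apply, measureReal_add_apply, measureReal_restrict_apply measurableSet_Ioc,
        measureReal_restrict_apply measurableSet_Ioc]
      rw [hI, Ioc_inter_Ioc] at *
      have hle : ∫ x in Ioc (s ⊔ x₁) (t ⊓ x₂), g x ≤
          μ.real (Ioc (s ⊔ x₁) (t ⊓ x₂)) - ν.real (Ioc (s ⊔ x₁) (t ⊓ x₂)) := by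
        rcases le_or_gt (s ⊔ x₁) (t ⊓ x₂) with h1 | h1
        · exact h _ _ le_sup_right h1 inf_le_right
        · simp [Ioc_eq_empty (not_lt.2 h1.le)]
      linarith
  have hm1 : AEMeasurable (fun x => ENNReal.ofReal (g' x)) volume :=
    hg'i.aestronglyMeasurable.aemeasurable.ennreal_ofReal
  have hm2 : AEMeasurable (fun x => ENNReal.ofReal (-g' x)) volume :=
    hg'i.neg.aestronglyMeasurable.aemeasurable.ennreal_ofReal
  constructor
  · have e1 := Measure.rnDeriv_add' (ν.restrict I + D₁) C volume
    have e2 := Measure.rnDeriv_add' (ν.restrict I) D₁ volume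
    have e3 := Measure.rnDeriv_add' (μ.restrict I) D₂ volume
    rw [hadd] at e1
    rw [ae_restrict_iff' hIm]
    filter_upwards [e1, e2, e3, μ.rnDeriv_restrict volume hIm, ν.rnDeriv_restrict volume hIm,
      Measure.rnDeriv_withDensity₀ volume hm1, Measure.rnDeriv_withDensity₀ volume hm2,
      μ.rnDeriv_lt_top volume, ν.rnDeriv_lt_top volume] with x k1 k2 k3 k4 k5 k6 k7 k8 k9 hx
    simp only [Pi.add_apply] at k1 k2 k3
    rw [← hD₁] at k6
    rw [← hD₂] at k7
    rw [k2, k3, k4, k5, k6, k7, indicator_of_mem hx, indicator_of_mem hx] at k1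
    have hle : ν.rnDeriv volume x + ENNReal.ofReal (g' x) ≤
        μ.rnDeriv volume x + ENNReal.ofReal (-g' x) := by rw [k1]; exact le_self_add
    have hgx : g' x = g x := indicator_of_mem hx _
    rw [hgx] at hle
    have := ENNReal.toReal_mono (by finiteness) hle
    rw [ENNReal.toReal_add k9.ne ENNReal.ofReal_ne_top,
      ENNReal.toReal_add k8.ne ENNReal.ofReal_ne_top, ENNReal.toReal_ofReal', ENNReal.toReal_ofReal'] at this
    unfold uaD
    have h5 : max (g x) 0 - max (-g x) 0 = g x := max_zero_sub_max_neg_zero_eq_self _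
    linarith
  · have e := congrArg (fun γ => Measure.singularPart γ volume) hadd
    simp only [Measure.singularPart_add] at e
    rw [hD₁, hD₂, Measure.singularPart_withDensity, Measure.singularPart_withDensity,
      Measure.singularPart_restrict _ _ hIm, Measure.singularPart_restrict _ _ hIm, add_zero,
      add_zero] at e
    have hs : (ν.singularPart volume).restrict I ⟂ₘ (μ.singularPart volume).restrict I :=
      (hμν.symm.mono (Measure.singularPart_le _ _) (Measure.singularPart_le _ _)).mono
        Measure.restrict_le_self Measure.restrict_le_self
    have := le_of_mutuallySingular_of_add_eq (α := 0) hs (by rw [e, add_zero])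
    have := this I
    rw [Measure.restrict_apply_self] at this
    simpa using this

theorem HasDistribRepr.le_of_ae_le {a b c x₁ x₂ z z' : ℝ} {f g : ℝ → ℝ} {μ ν : Measure ℝ}
    [IsFiniteMeasure μ] [IsFiniteMeasure ν] (h : HasDistribRepr a b f μ ν c)
    (ha : a ≤ x₁) (hb : x₂ ≤ b) (hg : IntegrableOn g (Ioo x₁ x₂))
    (hle : ∀ z z', x₁ < z → z ≤ z' → z' < x₂ → ∫ x in Ioc z z', g x ≤ f z' - f z)
    (h1 : x₁ < z) (h2 : z ≤ z') (h3 : z' < x₂) :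
    ∫ x in Ioc z z', g x ≤ μ.real (Ioc z z') - ν.real (Ioc z z') := by
  have hae : ∀ᵐ x ∂volume.restrict (Ioo x₁ x₂), f x = c + μ.real (Ioc a x) - ν.real (Ioc a x) :=
    ae_restrict_of_ae_restrict_of_subset (Ioo_subset_Ioo ha hb) h
  rw [ae_restrict_iff' measurableSet_Ioo] at hae
  set R : ℝ → ℝ := fun x => c + μ.real (Ioc a x) - ν.real (Ioc a x) with hR
  set G : ℝ → ℝ := fun x => ∫ t in z..x, g t with hG
  have hgz : ∀ x, x₁ < x → x < x₂ → IntervalIntegrable g volume z x := by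
    intro x hx hx'
    rw [intervalIntegrable_iff]
    refine hg.mono_set fun t ht => ?_
    rw [uIoc, mem_Ioc] at ht
    exact ⟨(lt_min h1 hx).trans ht.1, ht.2.trans_lt (max_lt (h2.trans_lt h3) hx')⟩
  have hGle : ∀ s t, x₁ < s → s ≤ t → t < x₂ → G t - G s ≤ f t - f s := by
    intro s t hs hst ht
    rw [hG]
    dsimp only
    rw [intervalIntegral.integral_interval_sub_left (hgz t (hs.trans_le hst) ht)
      (hgz s hs (hst.trans_lt ht)), intervalIntegral.integral_of_le hst]
    exact hle s t hs hst ht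
  have hGc : ∀ s, x₁ < s → s < x₂ → Tendsto G (𝓝[>] s) (𝓝 (G s)) := by
    intro s hs hs'
    obtain ⟨p, hp1, hp2⟩ := exists_between (lt_min hs h1)
    obtain ⟨q, hq1, hq2⟩ := exists_between (max_lt hs' (h2.trans_lt h3))
    have hII : IntegrableOn g (uIcc p q) := by
      refine hg.mono_set fun t ht => ?_
      have hpq : p ≤ q := ((hp2.trans_le (min_le_left _ _)).trans ((le_max_left _ _).trans_lt hq1)).le
      rw [uIcc_of_le hpq] at ht
      exact ⟨hp1.trans_le ht.1, ht.2.trans_lt hq2⟩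
    have hpz : p < z := hp2.trans_le (min_le_right _ _)
    have hzq : z < q := (le_max_right _ _).trans_lt hq1
    have hps : p < s := hp2.trans_le (min_le_left _ _)
    have hsq : s < q := (le_max_left _ _).trans_lt hq1
    have hc := intervalIntegral.continuousOn_primitive_interval' (μ := volume) (b₁ := p) (b₂ := q)
      (a := z) (f := g) ((intervalIntegrable_iff').2 hII) (by
        rw [uIcc_of_le (hpz.trans hzq).le]; exact ⟨hpz.le, hzq.le⟩)
    have := hc.continuousAt (x := s) (by
      rw [uIcc_of_le (hpz.trans hzq).le]; exact Icc_mem_nhds hps hsq)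
    exact this.tendsto.mono_left nhdsWithin_le_nhds
  have hRc : ∀ s, Tendsto R (𝓝[>] s) (𝓝 (R s)) := fun s =>
    ((tendsto_measureReal_Ioc_right μ a s).const_add c).sub (tendsto_measureReal_Ioc_right ν a s)
  have hfreq : ∀ s, x₁ < s → s < x₂ → ∃ᶠ x in 𝓝[>] s, f x = R x ∧ x < x₂ := by
    intro s hs hs' hev
    have : ∀ᵐ x, ¬ (x ∈ Ioo x₁ x₂ ∧ f x ≠ R x) := hae.mono fun x hx hx' => hx'.2 (hx hx'.1)
    obtain ⟨r, hr, hr'⟩ := mem_nhdsGT_iff_exists_Ioo_subset.1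
      (inter_mem hev (Ioo_mem_nhdsGT hs'))
    have hr : s < r := hr
    have hsub : Ioo s r ⊆ {x | ¬ ¬ (x ∈ Ioo x₁ x₂ ∧ f x ≠ R x)} := fun x hx => by
      obtain ⟨k1, k2⟩ := hr' hx
      simp only [mem_ofPred_eq, not_not]
      exact ⟨⟨hs.trans k2.1, k2.2⟩, fun he => k1 ⟨he, k2.2⟩⟩
    have := measure_mono_null hsub this
    rw [Real.volume_Ioo] at this
    simp at this
    linarith
  have hmain : G z' - G z ≤ R z' - R z := by
    rcases h2.eq_or_lt with rfl | hzz
    · simp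
    refine le_of_forall_pos_lt_add fun ε hε => ?_
    have hz2 : z' < x₂ := h3
    have hA : ∀ s, x₁ < s → s < x₂ → ∀ᶠ x in 𝓝[>] s, |R x - R s| < ε / 4 ∧ |G x - G s| < ε / 4 := by
      intro s hs hs'
      exact ((Metric.tendsto_nhds.1 (hRc s) _ (by positivity)).and
        (Metric.tendsto_nhds.1 (hGc s hs hs') _ (by positivity)))
    obtain ⟨s, ⟨hs1, -⟩, ⟨hs3, hs4⟩, hs5⟩ := ((hfreq z h1 (h2.trans_lt h3)).and_eventually
      ((hA z h1 (h2.trans_lt h3)).and (Ioo_mem_nhdsGT hzz))).exists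
    obtain ⟨t, ⟨ht1, ht2⟩, ⟨ht3, ht4⟩, ht5⟩ := ((hfreq z' (h1.trans_le h2) h3).and_eventually
      ((hA z' (h1.trans_le h2) h3).and self_mem_nhdsWithin)).exists
    have ht5 : z' < t := ht5
    have := hGle s t (h1.trans hs5.1) (hs5.2.trans ht5).le ht2
    rw [hs1, ht1] at this
    rw [abs_lt] at *
    linarith
  have hz0 : a ≤ z := ha.trans h1.le
  have hsplit : ∀ γ : Measure ℝ, IsFiniteMeasure γ →
      γ.real (Ioc a z') - γ.real (Ioc a z) = γ.real (Ioc z z') := by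
    intro γ _
    rw [← Ioc_union_Ioc_eq_Ioc hz0 h2, measureReal_union
      (by rw [Set.disjoint_left]; exact fun x hx hx' => absurd hx.2 (not_le.2 hx'.1)) measurableSet_Ioc]
    ring
  rw [← hsplit μ inferInstance, ← hsplit ν inferInstance, ← intervalIntegral.integral_of_le h2]
  simp only [hG, hR, intervalIntegral.integral_same] at hmain
  linarith

theorem HasDistribRepr.uaD_ge {a b c x₁ x₂ : ℝ} {f g : ℝ → ℝ} {μ ν : Measure ℝ}
    [IsFiniteMeasure μ] [IsFiniteMeasure ν] (h : HasDistribRepr a b f μ ν c) (hμν : μ ⟂ₘ ν)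
    (ha : a ≤ x₁) (hb : x₂ ≤ b) (hg : IntegrableOn g (Ioo x₁ x₂))
    (hle : ∀ z z', x₁ < z → z ≤ z' → z' < x₂ → ∫ x in Ioc z z', g x ≤ f z' - f z) :
    (∀ᵐ x ∂volume.restrict (Ioo x₁ x₂), g x ≤ uaD μ ν x) ∧
      ν.singularPart volume (Ioo x₁ x₂) = 0 := by
  have key : ∀ p q, x₁ < p → q < x₂ → (∀ᵐ x ∂volume.restrict (Ioc p q), g x ≤ uaD μ ν x) ∧
      ν.singularPart volume (Ioc p q) = 0 := fun p q hp hq =>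
    uaD_ge_of_integral_le hμν (hg.mono_set fun x hx => ⟨hp.trans hx.1, hx.2.trans_lt hq⟩)
      fun z z' h1 h2 h3 => h.le_of_ae_le ha hb hg hle (hp.trans_le h1) h2 (h3.trans_lt hq)
  constructor
  · rw [ae_restrict_iff' measurableSet_Ioo]
    change volume {x | ¬ (x ∈ Ioo x₁ x₂ → g x ≤ uaD μ ν x)} = 0
    refine measure_null_of_locally_null _ fun y hy => ?_
    simp only [mem_ofPred_eq, Classical.not_imp] at hy
    obtain ⟨p, hp, hp'⟩ := exists_between hy.1.1
    obtain ⟨q, hq, hq'⟩ := exists_between hy.1.2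
    refine ⟨_, inter_mem_nhdsWithin _ (Ioc_mem_nhds hp' hq), ?_⟩
    have := (key p q hp hq').1
    rw [ae_restrict_iff' measurableSet_Ioc] at this
    refine measure_mono_null (fun x hx => ?_) this
    exact fun hx' => hx.1 fun _ => hx' hx.2
  · refine measure_null_of_locally_null _ fun y hy => ?_
    obtain ⟨p, hp, hp'⟩ := exists_between hy.1
    obtain ⟨q, hq, hq'⟩ := exists_between hy.2
    exact ⟨_, mem_nhdsWithin_of_mem_nhds (Ioc_mem_nhds hp' hq), (key p q hp hq').2⟩

theorem HasDistribRepr.neg {a b c : ℝ} {f : ℝ → ℝ} {μ ν : Measure ℝ}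
    (h : HasDistribRepr a b f μ ν c) : HasDistribRepr a b (fun x => - f x) ν μ (-c) :=
  h.mono fun x hx => by simp only [hx]; ring

namespace PsiHyp

variable {ψ : ℝ → ℝ}

theorem psi1_sub (h : PsiHyp ψ) (s t : ℝ) : Psi1 ψ t - Psi1 ψ s = ∫ x in s..t, ψ x :=
  intervalIntegral.integral_Iic_sub_Iic h.integrable.integrableOn h.integrable.integrableOn

theorem psi1_strictMono (h : PsiHyp ψ) : StrictMono (Psi1 ψ) := fun s t hst => by
  have := intervalIntegral.intervalIntegral_pos_of_pos (h.integrable.intervalIntegrable (a := s) (b := t)) h.pos hst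
  rw [← h.psi1_sub] at this
  linarith

theorem psi1_continuous (h : PsiHyp ψ) : Continuous (Psi1 ψ) := by
  have : Psi1 ψ = fun t => Psi1 ψ 0 + ∫ x in (0 : ℝ)..t, ψ x := by
    ext t; rw [← h.psi1_sub]; ring
  rw [this]
  exact continuous_const.add
    (intervalIntegral.continuous_primitive (fun _ _ => h.integrable.intervalIntegrable) 0)

theorem psi1_tendsto_atBot (h : PsiHyp ψ) : Tendsto (Psi1 ψ) atBot (𝓝 0) := by
  have h1 := intervalIntegral_tendsto_integral_Iic (f := ψ) (μ := volume) (l := atBot) 0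
    h.integrable.integrableOn tendsto_id
  have h2 := h1.const_sub (Psi1 ψ 0)
  have : (Psi1 ψ 0) - ∫ x in Iic 0, ψ x = 0 := sub_self _
  rw [this] at h2
  refine h2.congr fun t => ?_
  rw [id, ← h.psi1_sub]; ring

theorem psi1_tendsto_atTop (h : PsiHyp ψ) : Tendsto (Psi1 ψ) atTop (𝓝 (∫ s, ψ s)) := by
  have h1 := intervalIntegral_tendsto_integral_Ioi (f := ψ) (μ := volume) (l := atTop) 0
    h.integrable.integrableOn tendsto_id
  have h2 := h1.const_add (Psi1 ψ 0)
  have : (Psi1 ψ 0) + ∫ x in Ioi 0, ψ x = ∫ s, ψ s :=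
    intervalIntegral.integral_Iic_add_Ioi h.integrable.integrableOn h.integrable.integrableOn
  rw [this] at h2
  refine h2.congr fun t => ?_
  rw [id, ← h.psi1_sub]; ring

theorem psi1_pos (h : PsiHyp ψ) (t : ℝ) : 0 < Psi1 ψ t :=
  (h.psi1_strictMono.monotone.le_of_tendsto h.psi1_tendsto_atBot (t - 1)).trans_lt
    (h.psi1_strictMono (by linarith))

theorem psi1_lt (h : PsiHyp ψ) (t : ℝ) : Psi1 ψ t < ∫ s, ψ s :=
  (h.psi1_strictMono (by linarith : t < t + 1)).trans_le
    (h.psi1_strictMono.monotone.ge_of_tendsto h.psi1_tendsto_atTop (t + 1))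

theorem exists_psi1_eq (h : PsiHyp ψ) {y : ℝ} (h0 : 0 < y) (h1 : y < ∫ s, ψ s) :
    ∃ t, Psi1 ψ t = y :=
  mem_range_of_exists_le_of_exists_ge h.psi1_continuous
    ((h.psi1_tendsto_atBot.eventually_le_const h0).exists)
    ((h.psi1_tendsto_atTop.eventually_const_le h1).exists)

theorem tendsto_of_psi1 (h : PsiHyp ψ) {ι : Type*} {l : Filter ι} {v : ι → ℝ} {w : ℝ}
    (hv : Tendsto (fun k => Psi1 ψ (v k)) l (𝓝 (Psi1 ψ w))) : Tendsto v l (𝓝 w) := by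
  refine tendsto_order.2 ⟨fun c hc => ?_, fun c hc => ?_⟩
  · exact (hv.eventually_const_lt (h.psi1_strictMono hc)).mono fun k hk =>
      h.psi1_strictMono.lt_iff_lt.1 hk
  · exact (hv.eventually_lt_const (h.psi1_strictMono hc)).mono fun k hk =>
      h.psi1_strictMono.lt_iff_lt.1 hk

end PsiHyp

theorem integral_comp_primitive_of_continuous {w : ℝ → ℝ} (hw : Integrable w) (A x y : ℝ)
    (ρ : BoundedContinuousFunction ℝ ℝ) :
    ∫ t in x..y, ρ (A + ∫ s in x..t, w s) * w t = ∫ s in A..(A + ∫ s in x..y, w s), ρ s := by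
  set V : ℝ → ℝ := fun t => A + ∫ s in x..t, w s with hV
  set F : ℝ → ℝ := fun r => ∫ s in (0 : ℝ)..r, ρ s with hF
  have hρi : ∀ r s, IntervalIntegrable ρ volume r s := fun r s => ρ.continuous.intervalIntegrable _ _
  have hFl : ∀ r s, dist (F r) (F s) ≤ ‖ρ‖ * dist r s := by
    intro r s
    rw [Real.dist_eq, Real.dist_eq, hF]
    dsimp only
    rw [intervalIntegral.integral_interval_sub_left (hρi _ _) (hρi _ _)]
    exact intervalIntegral.norm_integral_le_of_norm_le_const fun t _ => ρ.norm_coe_le_norm t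
  have hFd : ∀ r, HasDerivAt F (ρ r) r := fun r =>
    intervalIntegral.integral_hasDerivAt_right (hρi _ _)
      (ρ.continuous.stronglyMeasurableAtFilter _ _) ρ.continuous.continuousAt
  have hVac : AbsolutelyContinuousOnInterval V x y := by
    have h1 := (hw.intervalIntegrable (a := x) (b := y)).absolutelyContinuousOnInterval_intervalIntegral
      (c := x) left_mem_uIcc
    have : V = (fun _ => A) + fun t => ∫ s in x..t, w s := rfl
    unfold AbsolutelyContinuousOnInterval at h1 ⊢
    simpa [hV] using h1
  have hac : AbsolutelyContinuousOnInterval (F ∘ V) x y := by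
    unfold AbsolutelyContinuousOnInterval at hVac ⊢
    have := hVac.const_mul ‖ρ‖
    rw [mul_zero] at this
    refine squeeze_zero (fun E => Finset.sum_nonneg fun _ _ => dist_nonneg) (fun E => ?_) this
    rw [Finset.mul_sum]
    exact Finset.sum_le_sum fun i _ => hFl _ _
  have h1 := hac.integral_deriv_eq_sub
  have h2 : ∫ t in x..y, deriv (F ∘ V) t = ∫ t in x..y, ρ (V t) * w t := by
    refine intervalIntegral.integral_congr_ae ?_
    filter_upwards [(hw.intervalIntegrable (a := x) (b := y)).ae_hasDerivAt_integral] with t ht htm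
    have := (ht (uIoc_subset_uIcc htm) x left_mem_uIcc).const_add A
    exact ((hFd (V t)).comp t this).deriv
  rw [← h2, h1]
  simp only [Function.comp, hF]
  rw [intervalIntegral.integral_interval_sub_left (hρi _ _) (hρi _ _)]
  simp [hV]

theorem abs_integral_le_integral_comp_primitive {ψ : ℝ → ℝ} (hψ : Measurable ψ)
    (h0 : ∀ t, 0 ≤ ψ t) {C : ℝ} (hC : ∀ t, ψ t ≤ C) {w : ℝ → ℝ} (hw : Integrable w)
    (A : ℝ) {x y : ℝ} (hxy : x ≤ y) :
    |∫ s in A..(A + ∫ s in x..y, w s), ψ s| ≤ ∫ t in x..y, ψ (A + ∫ s in x..t, w s) * |w t| := by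
  set V : ℝ → ℝ := fun t => A + ∫ s in x..t, w s with hV
  have hVc : Continuous V := continuous_const.add
    (intervalIntegral.continuous_primitive (fun _ _ => hw.intervalIntegrable) x)
  set μ := volume.restrict (Ioc x y) with hμ
  have hwi : Integrable w μ := hw.restrict
  set D₁ := μ.withDensity fun t => ENNReal.ofReal (w t) with hD₁
  set D₂ := μ.withDensity fun t => ENNReal.ofReal (-w t) with hD₂
  have f₁ : IsFiniteMeasure D₁ := isFiniteMeasure_withDensity_ofReal hwi.2
  have f₂ : IsFiniteMeasure D₂ := isFiniteMeasure_withDensity_ofReal hwi.neg.2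
  have hm1 : AEMeasurable (fun t => ENNReal.ofReal (w t)) μ :=
    hwi.aestronglyMeasurable.aemeasurable.ennreal_ofReal
  have hm2 : AEMeasurable (fun t => ENNReal.ofReal (-w t)) μ :=
    hwi.neg.aestronglyMeasurable.aemeasurable.ennreal_ofReal
  set B := V y with hB
  set P := volume.restrict (Ioc A B)
  set N := volume.restrict (Ioc B A)
  have hsub : ∀ ρ : ℝ → ℝ, Measurable ρ → (∃ K, ∀ t, ‖ρ t‖ ≤ K) →
      (∫ r, ρ r ∂(D₁.map V)) - ∫ r, ρ r ∂(D₂.map V) = ∫ t in x..y, ρ (V t) * w t := by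
    rintro ρ hρ ⟨K, hK⟩
    rw [integral_map hVc.aemeasurable hρ.aestronglyMeasurable,
      integral_map hVc.aemeasurable hρ.aestronglyMeasurable, hD₁, hD₂,
      integral_withDensity_eq_integral_toReal_smul₀ hm1 (by simp),
      integral_withDensity_eq_integral_toReal_smul₀ hm2 (by simp),
      intervalIntegral.integral_of_le hxy]
    have hb : ∀ᵐ t ∂μ, ‖ρ (V t)‖ ≤ K := Eventually.of_forall fun t => hK _
    have hms : AEStronglyMeasurable (fun t => ρ (V t)) μ :=
      (hρ.comp hVc.measurable).aestronglyMeasurable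
    simp only [ENNReal.toReal_ofReal', smul_eq_mul]
    rw [← integral_sub (hwi.pos_part.mul_bdd hms hb) (hwi.neg_part.mul_bdd hms hb)]
    refine integral_congr_ae (Eventually.of_forall fun t => ?_)
    have h5 : max (w t) 0 - max (-w t) 0 = w t := max_zero_sub_max_neg_zero_eq_self _
    dsimp only
    rw [← sub_mul, h5, mul_comm]
  have hbi : ∀ (γ : Measure ℝ) [IsFiniteMeasure γ] (ρ : ℝ → ℝ), Measurable ρ →
      (∃ K, ∀ t, ‖ρ t‖ ≤ K) → Integrable ρ γ := by
    rintro γ _ ρ hρ ⟨K, hK⟩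
    exact Integrable.of_bound hρ.aestronglyMeasurable K (Eventually.of_forall hK)
  have heq : D₁.map V + N = D₂.map V + P := by
    refine ext_of_forall_integral_eq_of_IsFiniteMeasure fun ρ => ?_
    have hb : ∃ K, ∀ t, ‖ρ t‖ ≤ K := ⟨‖ρ‖, ρ.norm_coe_le_norm⟩
    have hm : Measurable ρ := ρ.continuous.measurable
    rw [integral_add_measure (hbi _ _ hm hb) (hbi _ _ hm hb),
      integral_add_measure (hbi _ _ hm hb) (hbi _ _ hm hb)]
    have e1 := hsub ρ hm hb
    have e2 := integral_comp_primitive_of_continuous hw A x y ρ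
    rw [e2] at e1
    change _ = (∫ r, ρ r ∂P) - (∫ r, ρ r ∂N) at e1
    linarith
  have hψb : ∃ K, ∀ t, ‖ψ t‖ ≤ K := ⟨C, fun t => by rw [Real.norm_of_nonneg (h0 t)]; exact hC t⟩
  have e3 := congrArg (fun γ => ∫ r, ψ r ∂γ) heq
  rw [integral_add_measure (hbi _ _ hψ hψb) (hbi _ _ hψ hψb),
      integral_add_measure (hbi _ _ hψ hψb) (hbi _ _ hψ hψb)] at e3
  have e4 := hsub ψ hψ hψb
  have e5 : ∫ s in A..B, ψ s = ∫ t in x..y, ψ (V t) * w t := by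
    change (∫ r, ψ r ∂P) - (∫ r, ψ r ∂N) = _
    linarith
  rw [e5]
  refine (intervalIntegral.abs_integral_le_integral_abs hxy).trans (le_of_eq ?_)
  refine intervalIntegral.integral_congr fun t _ => ?_
  rw [abs_mul, abs_of_nonneg (h0 _)]

theorem PsiHyp.abs_psi1_sub_le {ψ : ℝ → ℝ} (hψ : PsiHyp ψ) {a b : ℝ} {v w : ℝ → ℝ}
    (hw : IntegrableOn w (Ioo a b))
    (hv : ∀ x ∈ Ioo a b, ∀ y ∈ Ioo a b, v y - v x = ∫ t in x..y, w t)
    {x y : ℝ} (hx : x ∈ Ioo a b) (hy : y ∈ Ioo a b) (hxy : x ≤ y) :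
    |Psi1 ψ (v y) - Psi1 ψ (v x)| ≤ ∫ t in Ioc x y, ψ (v t) * |w t| := by
  obtain ⟨C, hC⟩ := hψ.bounded
  have hw' : Integrable ((Ioo a b).indicator w) := hw.integrable_indicator measurableSet_Ioo
  have hprim : ∀ t ∈ Icc x y, v x + ∫ s in x..t, (Ioo a b).indicator w s = v t := by
    intro t ht
    have htab : t ∈ Ioo a b := ⟨hx.1.trans_le ht.1, ht.2.trans_lt hy.2⟩
    have : ∫ s in x..t, (Ioo a b).indicator w s = ∫ s in x..t, w s := by
      refine intervalIntegral.integral_congr fun s hs => ?_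
      rw [uIcc_of_le ht.1] at hs
      exact indicator_of_mem (show s ∈ Ioo a b from ⟨hx.1.trans_le hs.1, hs.2.trans_lt htab.2⟩) _
    rw [this, ← hv x hx t htab]; ring
  have h := abs_integral_le_integral_comp_primitive hψ.measurable (fun t => (hψ.pos t).le) hC hw'
    (v x) hxy
  rw [hprim y (right_mem_Icc.2 hxy), ← hψ.psi1_sub] at h
  refine h.trans (le_of_eq ?_)
  rw [intervalIntegral.integral_of_le hxy]
  refine setIntegral_congr_fun measurableSet_Ioc fun t ht => ?_
  rw [hprim t (Ioc_subset_Icc_self ht), indicator_of_mem (show t ∈ Ioo a b from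
    ⟨hx.1.trans ht.1, ht.2.trans_lt hy.2⟩)]

theorem eventually_forall_abs_sub_lt {a b : ℝ} {f T : ℕ → ℝ → ℝ} {g G : ℝ → ℝ}
    (hT : ∀ k, Monotone (T k))
    (hfT : ∀ k, ∀ x ∈ Ioo a b, ∀ y ∈ Ioo a b, x ≤ y → |f k y - f k x| ≤ T k y - T k x)
    (hTG : ∀ x, Tendsto (fun k => T k x) atTop (𝓝 (G x))) {y : ℝ} (hy : y ∈ Ioo a b)
    (hfg : Tendsto (fun k => f k y) atTop (𝓝 (g y))) (hG : ContinuousAt G y) {δ : ℝ} (hδ : 0 < δ) :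
    ∃ x₁ x₂, a ≤ x₁ ∧ x₁ < y ∧ y < x₂ ∧ x₂ ≤ b ∧
      ∀ᶠ k in atTop, ∀ z ∈ Ioo x₁ x₂, |f k z - g y| < δ := by
  have hnear : {x | |G x - G y| < δ / 8} ∩ Ioo a b ∈ 𝓝 y :=
    inter_mem (Metric.tendsto_nhds.1 hG _ (by positivity)) (Ioo_mem_nhds hy.1 hy.2)
  obtain ⟨p, q, ⟨hpy, hyq⟩, hpq⟩ := mem_nhds_iff_exists_Ioo_subset.1 hnear
  obtain ⟨x₁, h1, h1'⟩ := exists_between hpy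
  obtain ⟨x₂, h2, h2'⟩ := exists_between hyq
  have m1 := hpq ⟨h1, h1'.trans hyq⟩
  have m2 := hpq ⟨hpy.trans h2, h2'⟩
  refine ⟨x₁, x₂, m1.2.1.le, h1', h2, m2.2.2.le, ?_⟩
  filter_upwards [Metric.tendsto_nhds.1 (hTG x₁) (δ / 8) (by positivity),
    Metric.tendsto_nhds.1 (hTG x₂) (δ / 8) (by positivity),
    Metric.tendsto_nhds.1 hfg (δ / 8) (by positivity)] with k k1 k2 k3 z hz
  rw [Real.dist_eq] at k1 k2 k3
  have hm : |f k z - f k y| ≤ T k x₂ - T k x₁ := by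
    have hz' : z ∈ Ioo a b := ⟨m1.2.1.trans hz.1, hz.2.trans m2.2.2⟩
    rcases le_total y z with hyz | hyz
    · refine (hfT k y hy z hz' hyz).trans ?_
      linarith [hT k hz.2.le, hT k h1'.le]
    · rw [abs_sub_comm]
      refine (hfT k z hz' y hy hyz).trans ?_
      linarith [hT k hz.1.le, hT k h2.le]
  have e1 := m1.1
  have e2 := m2.1
  simp only [mem_ofPred_eq] at e1 e2
  rw [abs_lt] at *
  rw [abs_le] at hm
  constructor <;> linarith

theorem HasDistribRepr.uaD_ge_of_eventually_le {a b c x₁ x₂ r : ℝ} {f : ℝ → ℝ} {μ ν : Measure ℝ}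
    [IsFiniteMeasure μ] [IsFiniteMeasure ν] (h : HasDistribRepr a b f μ ν c) (hμν : μ ⟂ₘ ν)
    {F v : ℕ → ℝ → ℝ} (hF : ∀ x ∈ Ioo a b, Tendsto (fun k => F k x) atTop (𝓝 (f x)))
    (hFv : ∀ k, ∀ x ∈ Ioo a b, ∀ y ∈ Ioo a b, F k y - F k x = ∫ t in x..y, v k t)
    (hv : ∀ k, IntegrableOn (v k) (Ioo a b)) (ha : a ≤ x₁) (hb : x₂ ≤ b)
    (hr : ∀ᶠ k in atTop, ∀ z ∈ Ioo x₁ x₂, r ≤ v k z) :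
    (∀ᵐ x ∂volume.restrict (Ioo x₁ x₂), r ≤ uaD μ ν x) ∧
      ν.singularPart volume (Ioo x₁ x₂) = 0 := by
  refine h.uaD_ge hμν ha hb (g := fun _ => r) (integrableOn_const (by simp))
    fun z z' h1 h2 h3 => ?_
  have hz : z ∈ Ioo a b := ⟨ha.trans_lt h1, (h2.trans_lt h3).trans_le hb⟩
  have hz' : z' ∈ Ioo a b := ⟨hz.1.trans_le h2, h3.trans_le hb⟩
  refine ge_of_tendsto ((hF z' hz').sub (hF z hz)) (hr.mono fun k hk => ?_)
  rw [hFv k z hz z' hz', intervalIntegral.integral_of_le h2]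
  refine setIntegral_mono_on (integrableOn_const (by simp)) ((hv k).mono_set
    fun t ht => ⟨hz.1.trans ht.1, ht.2.trans_lt hz'.2⟩) measurableSet_Ioc
    fun t ht => hk t ⟨h1.trans ht.1, ht.2.trans_lt h3⟩

theorem HasDistribRepr.uaD_le_of_eventually_le {a b c x₁ x₂ r : ℝ} {f : ℝ → ℝ} {μ ν : Measure ℝ}
    [IsFiniteMeasure μ] [IsFiniteMeasure ν] (h : HasDistribRepr a b f μ ν c) (hμν : μ ⟂ₘ ν)
    {F v : ℕ → ℝ → ℝ} (hF : ∀ x ∈ Ioo a b, Tendsto (fun k => F k x) atTop (𝓝 (f x)))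
    (hFv : ∀ k, ∀ x ∈ Ioo a b, ∀ y ∈ Ioo a b, F k y - F k x = ∫ t in x..y, v k t)
    (hv : ∀ k, IntegrableOn (v k) (Ioo a b)) (ha : a ≤ x₁) (hb : x₂ ≤ b)
    (hr : ∀ᶠ k in atTop, ∀ z ∈ Ioo x₁ x₂, v k z ≤ r) :
    (∀ᵐ x ∂volume.restrict (Ioo x₁ x₂), uaD μ ν x ≤ r) ∧
      μ.singularPart volume (Ioo x₁ x₂) = 0 := by
  obtain ⟨h1, h2⟩ := h.neg.uaD_ge_of_eventually_le hμν.symm (F := fun k x => - F k x)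
    (v := fun k x => - v k x) (r := -r) (fun x hx => (hF x hx).neg)
    (fun k x hx y hy => by rw [intervalIntegral.integral_neg, ← hFv k x hx y hy]; ring)
    (fun k => (hv k).neg) ha hb (hr.mono fun k hk z hz => neg_le_neg (hk z hz))
  refine ⟨h1.mono fun x hx => ?_, h2⟩
  unfold uaD at *
  linarith

theorem integrable_uaD (μ ν : Measure ℝ) [IsFiniteMeasure μ] [IsFiniteMeasure ν] :
    Integrable (uaD μ ν) :=
  Measure.integrable_toReal_rnDeriv.sub Measure.integrable_toReal_rnDeriv

theorem mem_ZPlus_of_forall {a b : ℝ} {g : ℝ → ℝ} (hg : Integrable g) {y : ℝ} (hy : y ∈ Ioo a b)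
    (h : ∀ r : ℝ, ∃ x₁ x₂, x₁ < y ∧ y < x₂ ∧ ∀ᵐ x ∂volume.restrict (Ioo x₁ x₂), r ≤ g x) :
    y ∈ ZPlus a b g := by
  refine ⟨hy, tendsto_atTop.2 fun r => ?_⟩
  obtain ⟨x₁, x₂, h1, h2, h3⟩ := h r
  filter_upwards [Ioo_mem_nhdsGT (sub_pos.2 h1), Ioo_mem_nhdsGT (sub_pos.2 h2)] with ε e1 e2
  rw [le_div_iff₀ (by linarith [e1.1])]
  have hsub : Ioo (y - ε) (y + ε) ⊆ Ioo x₁ x₂ :=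
    Ioo_subset_Ioo (by linarith [e1.2]) (by linarith [e2.2])
  calc r * (2 * ε) = ∫ _ in Ioo (y - ε) (y + ε), r := by
        rw [setIntegral_const, smul_eq_mul, Real.volume_real_Ioo_of_le (by linarith [e1.1])]
        ring
    _ ≤ _ := setIntegral_mono_ae_restrict (integrableOn_const (by simp)) hg.integrableOn
        (ae_restrict_of_ae_restrict_of_subset hsub h3)

theorem mem_ZMinus_of_forall {a b : ℝ} {g : ℝ → ℝ} (hg : Integrable g) {y : ℝ} (hy : y ∈ Ioo a b)
    (h : ∀ r : ℝ, ∃ x₁ x₂, x₁ < y ∧ y < x₂ ∧ ∀ᵐ x ∂volume.restrict (Ioo x₁ x₂), g x ≤ r) :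
    y ∈ ZMinus a b g := by
  have := (mem_ZPlus_of_forall hg.neg hy fun r => by
    obtain ⟨x₁, x₂, h1, h2, h3⟩ := h (-r)
    exact ⟨x₁, x₂, h1, h2, h3.mono fun x hx => by simp only [Pi.neg_apply]; linarith⟩).2
  refine ⟨hy, (tendsto_neg_atTop_atBot.comp this).congr fun ε => ?_⟩
  simp only [Function.comp, Pi.neg_apply, integral_neg, neg_div, neg_neg]

theorem ae_lt_top_of_integral_abs_le {a b C : ℝ} {v : ℕ → ℝ → ℝ}
    (hv : ∀ k, IntegrableOn (v k) (Ioo a b)) (hC : ∀ k, ∫ x in Ioo a b, |v k x| ≤ C) :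
    ∀ᵐ x ∂volume.restrict (Ioo a b), ∃ R : ℝ, ∃ᶠ k in atTop, |v k x| ≤ R := by
  have h1 : ∫⁻ x in Ioo a b, liminf (fun k => ‖v k x‖ₑ) atTop ≤ ENNReal.ofReal C := by
    refine (lintegral_liminf_le' fun k => (hv k).aestronglyMeasurable.enorm).trans ?_
    refine liminf_le_of_frequently_le' (Frequently.of_forall fun k => ?_)
    rw [← ofReal_integral_norm_eq_lintegral_enorm (hv k)]
    exact ENNReal.ofReal_le_ofReal (hC k)
  have hm : AEMeasurable (fun x => liminf (fun k => ‖v k x‖ₑ) atTop)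
      (volume.restrict (Ioo a b)) := by
    simp only [liminf_eq_iSup_iInf_of_nat]
    exact .iSup fun n => .iInf fun k => .iInf fun _ => (hv k).aestronglyMeasurable.enorm
  have h2 := ae_lt_top' hm
    (h1.trans_lt ENNReal.ofReal_lt_top).ne
  filter_upwards [h2] with x hx
  obtain ⟨R, hR1, hR2⟩ := ENNReal.lt_iff_exists_nnreal_btwn.1 hx
  refine ⟨R, (frequently_lt_of_liminf_lt (by isBoundedDefault) hR1).mono fun k hk => ?_⟩
  rw [← Real.norm_eq_abs]
  have := ENNReal.toReal_mono ENNReal.coe_ne_top hk.le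
  simpa using this

theorem ae_imp_of_locally {P Q : ℝ → Prop}
    (h : ∀ y, P y → ∃ x₁ x₂, x₁ < y ∧ y < x₂ ∧ ∀ᵐ x ∂volume.restrict (Ioo x₁ x₂), Q x) :
    ∀ᵐ x, P x → Q x := by
  change volume {x | ¬ (P x → Q x)} = 0
  refine measure_null_of_locally_null _ fun y hy => ?_
  simp only [mem_ofPred_eq, Classical.not_imp] at hy
  obtain ⟨x₁, x₂, h1, h2, h3⟩ := h y hy.1
  refine ⟨_, inter_mem_nhdsWithin _ (Ioo_mem_nhds h1 h2), ?_⟩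
  rw [ae_restrict_iff' measurableSet_Ioo] at h3
  refine measure_mono_null (fun x hx => ?_) h3
  exact fun hx' => hx.1 fun _ => hx' hx.2

theorem PsiHyp.ae_psi1_limit_mem {ψ : ℝ → ℝ} (hψ : PsiHyp ψ) {a b C : ℝ} {v : ℕ → ℝ → ℝ}
    {V : ℝ → ℝ} (hv : ∀ k, IntegrableOn (v k) (Ioo a b)) (hC : ∀ k, ∫ x in Ioo a b, |v k x| ≤ C)
    (hV : ∀ x ∈ Ioo a b, Tendsto (fun k => Psi1 ψ (v k x)) atTop (𝓝 (V x))) :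
    ∀ᵐ x ∂volume.restrict (Ioo a b), 0 < V x ∧ V x < ∫ s, ψ s := by
  filter_upwards [ae_lt_top_of_integral_abs_le hv hC, ae_restrict_mem measurableSet_Ioo]
    with x ⟨R, hR⟩ hx
  constructor
  · by_contra! h0
    have h1 := (hV x hx).eventually_lt_const (h0.trans_lt (hψ.psi1_pos (-R - 1)))
    obtain ⟨k, hk1, hk2⟩ := (hR.and_eventually h1).exists
    have := hψ.psi1_strictMono.lt_iff_lt.1 hk2
    linarith [neg_abs_le (v k x)]
  · by_contra! h0
    have h1 := (hV x hx).eventually_const_lt ((hψ.psi1_lt (R + 1)).trans_le h0)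
    obtain ⟨k, hk1, hk2⟩ := (hR.and_eventually h1).exists
    have := hψ.psi1_strictMono.lt_iff_lt.1 hk2
    linarith [le_abs_self (v k x)]

theorem restrict_singularPart_compl_eq_zero {a b : ℝ} {μ : Measure ℝ} {J Z D : Set ℝ}
    (hJ : J.Countable) (hD : D.Countable) (hμ : μ (Ioo a b)ᶜ = 0)
    (hatom : ∀ y ∈ Ioo a b, y ∉ J → μ {y} = 0)
    (hloc : ∀ y ∈ Ioo a b, y ∉ D → y ∉ Z →
      ∃ x₁ x₂, x₁ < y ∧ y < x₂ ∧ μ.singularPart volume (Ioo x₁ x₂) = 0) :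
    ((μ.singularPart volume).restrict Jᶜ) Zᶜ = 0 := by
  have hle : ∀ s, μ s = 0 → μ.singularPart volume s = 0 := fun s hs =>
    le_antisymm ((Measure.singularPart_le μ volume s).trans hs.le) zero_le
  rw [Measure.restrict_apply' hJ.measurableSet.compl]
  have hsub : Zᶜ ∩ Jᶜ ⊆ (Ioo a b)ᶜ ∪ (⋃ y ∈ D ∩ (Ioo a b ∩ Jᶜ), {y}) ∪ (Ioo a b ∩ (Dᶜ ∩ Zᶜ)) := by
    intro y hy
    by_cases h1 : y ∈ Ioo a b
    · by_cases h2 : y ∈ D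
      · refine Or.inl (Or.inr ?_)
        simp only [mem_iUnion, mem_singleton_iff]
        exact ⟨y, ⟨h2, h1, hy.2⟩, rfl⟩
      · exact Or.inr ⟨h1, h2, hy.1⟩
    · exact Or.inl (Or.inl h1)
  refine measure_mono_null hsub (measure_union_null (measure_union_null (hle _ hμ) ?_) ?_)
  · rw [measure_biUnion_null_iff (hD.mono inter_subset_left)]
    exact fun y hy => hle _ (hatom y hy.2.1 hy.2.2)
  · refine measure_null_of_locally_null _ fun y hy => ?_
    obtain ⟨x₁, x₂, h1, h2, h3⟩ := hloc y hy.1 hy.2.1 hy.2.2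
    exact ⟨_, mem_nhdsWithin_of_mem_nhds (Ioo_mem_nhds h1 h2), h3⟩

theorem PsiHyp.limit_structure {ψ : ℝ → ℝ} (hψ : PsiHyp ψ) {a b c C : ℝ} {F v A : ℕ → ℝ → ℝ}
    {f V G : ℝ → ℝ} {μ ν : Measure ℝ} [IsFiniteMeasure μ] [IsFiniteMeasure ν]
    (h : HasDistribRepr a b f μ ν c) (hμν : μ ⟂ₘ ν) (hf : IntegrableOn f (Ioo a b))
    (hμ : μ (Ioo a b)ᶜ = 0) (hν : ν (Ioo a b)ᶜ = 0)
    (hF : ∀ x ∈ Ioo a b, Tendsto (fun k => F k x) atTop (𝓝 (f x)))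
    (hFv : ∀ k, ∀ x ∈ Ioo a b, ∀ y ∈ Ioo a b, F k y - F k x = ∫ t in x..y, v k t)
    (hv : ∀ k, IntegrableOn (v k) (Ioo a b)) (hC : ∀ k, ∫ x in Ioo a b, |v k x| ≤ C)
    (hA : ∀ k, Monotone (A k)) (hG : Monotone G)
    (hAG : ∀ x, Tendsto (fun k => A k x) atTop (𝓝 (G x)))
    (hvA : ∀ k, ∀ x ∈ Ioo a b, ∀ y ∈ Ioo a b, x ≤ y →
      |Psi1 ψ (v k y) - Psi1 ψ (v k x)| ≤ A k y - A k x)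
    (hV : ∀ x ∈ Ioo a b, Tendsto (fun k => Psi1 ψ (v k x)) atTop (𝓝 (V x))) :
    (∀ᵐ x ∂volume.restrict (Ioo a b), Psi1 ψ (uaD μ ν x) = V x) ∧
      cantorPos a b f μ (ZPlus a b (uaD μ ν))ᶜ = 0 ∧
      cantorNeg a b f ν (ZMinus a b (uaD μ ν))ᶜ = 0 := by
  have hlow : ∀ y ∈ Ioo a b, ContinuousAt G y → ∀ r, Psi1 ψ r < V y →
      ∃ x₁ x₂, x₁ < y ∧ y < x₂ ∧ (∀ᵐ x ∂volume.restrict (Ioo x₁ x₂), r ≤ uaD μ ν x) ∧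
        ν.singularPart volume (Ioo x₁ x₂) = 0 := by
    intro y hy hc r hr
    obtain ⟨x₁, x₂, h1, h2, h3, h4, h5⟩ := eventually_forall_abs_sub_lt
      (f := fun k x => Psi1 ψ (v k x)) hA hvA hAG hy (hV y hy) hc (sub_pos.2 hr)
    refine ⟨x₁, x₂, h2, h3, h.uaD_ge_of_eventually_le hμν hF hFv hv h1 h4 (h5.mono fun k hk z hz => ?_)⟩
    have := (abs_lt.1 (hk z hz)).1
    exact (hψ.psi1_strictMono.lt_iff_lt.1 (by linarith : Psi1 ψ r < Psi1 ψ (v k z))).le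
  have hup : ∀ y ∈ Ioo a b, ContinuousAt G y → ∀ r, V y < Psi1 ψ r →
      ∃ x₁ x₂, x₁ < y ∧ y < x₂ ∧ (∀ᵐ x ∂volume.restrict (Ioo x₁ x₂), uaD μ ν x ≤ r) ∧
        μ.singularPart volume (Ioo x₁ x₂) = 0 := by
    intro y hy hc r hr
    obtain ⟨x₁, x₂, h1, h2, h3, h4, h5⟩ := eventually_forall_abs_sub_lt
      (f := fun k x => Psi1 ψ (v k x)) hA hvA hAG hy (hV y hy) hc (sub_pos.2 hr)
    refine ⟨x₁, x₂, h2, h3, h.uaD_le_of_eventually_le hμν hF hFv hv h1 h4 (h5.mono fun k hk z hz => ?_)⟩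
    have := (abs_lt.1 (hk z hz)).2
    exact (hψ.psi1_strictMono.lt_iff_lt.1 (by linarith : Psi1 ψ (v k z) < Psi1 ψ r)).le
  have hD : {x | ¬ ContinuousAt G x}.Countable := hG.countable_not_continuousAt
  have hJ := h.countable_jumpSet hf
  have hV0 : ∀ y ∈ Ioo a b, 0 ≤ V y := fun y hy =>
    ge_of_tendsto' (hV y hy) fun k => (hψ.psi1_pos _).le
  have hV1 : ∀ y ∈ Ioo a b, V y ≤ ∫ s, ψ s := fun y hy =>
    le_of_tendsto' (hV y hy) fun k => (hψ.psi1_lt _).le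
  have hLpos : 0 < ∫ s, ψ s := (hψ.psi1_pos 0).trans (hψ.psi1_lt 0)
  refine ⟨?_, ?_, ?_⟩
  · have e1 : ∀ᵐ x, ∀ q : ℚ, (x ∈ Ioo a b ∧ ContinuousAt G x ∧ Psi1 ψ q < V x) → q ≤ uaD μ ν x :=
      ae_all_iff.2 fun q => ae_imp_of_locally fun y ⟨hy, hc, hq⟩ => by
        obtain ⟨x₁, x₂, h1, h2, h3, -⟩ := hlow y hy hc q hq
        exact ⟨x₁, x₂, h1, h2, h3⟩
    have e2 : ∀ᵐ x, ∀ q : ℚ, (x ∈ Ioo a b ∧ ContinuousAt G x ∧ V x < Psi1 ψ q) → uaD μ ν x ≤ q :=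
      ae_all_iff.2 fun q => ae_imp_of_locally fun y ⟨hy, hc, hq⟩ => by
        obtain ⟨x₁, x₂, h1, h2, h3, -⟩ := hup y hy hc q hq
        exact ⟨x₁, x₂, h1, h2, h3⟩
    filter_upwards [ae_restrict_of_ae e1, ae_restrict_of_ae e2,
      ae_restrict_of_ae (hD.ae_notMem volume), hψ.ae_psi1_limit_mem hv hC hV,
      ae_restrict_mem measurableSet_Ioo] with x k1 k2 k3 k4 hx
    have hc : ContinuousAt G x := not_not.1 k3
    obtain ⟨t, ht⟩ := hψ.exists_psi1_eq k4.1 k4.2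
    rw [← ht]
    congr 1
    refine le_antisymm (le_of_forall_gt_imp_ge_of_dense fun s hs => ?_)
      (le_of_forall_lt_imp_le_of_dense fun s hs => ?_)
    · obtain ⟨q, hq1, hq2⟩ := exists_rat_btwn hs
      exact (k2 q ⟨hx, hc, ht ▸ hψ.psi1_strictMono hq1⟩).trans hq2.le
    · obtain ⟨q, hq1, hq2⟩ := exists_rat_btwn hs
      exact hq1.le.trans (k1 q ⟨hx, hc, ht ▸ hψ.psi1_strictMono hq2⟩)
  · refine restrict_singularPart_compl_eq_zero hJ hD hμ
      (fun y hy hyJ => (h.measure_singleton_eq_zero hf hμν hy hyJ).1) fun y hy hyD hyZ => ?_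
    have hc : ContinuousAt G y := not_not.1 hyD
    rcases (hV1 y hy).lt_or_eq with hlt | heq
    · obtain ⟨r, hr⟩ := (hψ.psi1_tendsto_atTop.eventually_const_lt hlt).exists
      obtain ⟨x₁, x₂, h1, h2, -, h3⟩ := hup y hy hc r hr
      exact ⟨x₁, x₂, h1, h2, h3⟩
    · refine absurd (mem_ZPlus_of_forall (integrable_uaD μ ν) hy fun r => ?_) hyZ
      obtain ⟨x₁, x₂, h1, h2, h3, -⟩ := hlow y hy hc r (heq ▸ hψ.psi1_lt r)
      exact ⟨x₁, x₂, h1, h2, h3⟩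
  · refine restrict_singularPart_compl_eq_zero hJ hD hν
      (fun y hy hyJ => (h.measure_singleton_eq_zero hf hμν hy hyJ).2) fun y hy hyD hyZ => ?_
    have hc : ContinuousAt G y := not_not.1 hyD
    rcases (hV0 y hy).lt_or_eq with hlt | heq
    · obtain ⟨r, hr⟩ := (hψ.psi1_tendsto_atBot.eventually_lt_const hlt).exists
      obtain ⟨x₁, x₂, h1, h2, -, h3⟩ := hlow y hy hc r hr
      exact ⟨x₁, x₂, h1, h2, h3⟩
    · refine absurd (mem_ZMinus_of_forall (integrable_uaD μ ν) hy fun r => ?_) hyZ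
      obtain ⟨x₁, x₂, h1, h2, h3, -⟩ := hup y hy hc r (heq ▸ hψ.psi1_pos r)
      exact ⟨x₁, x₂, h1, h2, h3⟩

theorem exists_monotone_primitive {a b : ℝ} {g : ℝ → ℝ} (hg : IntegrableOn g (Ioo a b))
    (h0 : ∀ x, 0 ≤ g x) :
    ∃ T : ℝ → ℝ, Monotone T ∧ (∀ x, |T x| ≤ ∫ t in Ioo a b, g t) ∧
      ∀ x ∈ Ioo a b, ∀ y ∈ Ioo a b, x ≤ y → T y - T x = ∫ t in Ioc x y, g t := by
  have hi : ∀ x, IntegrableOn g (Ioo a b ∩ Iic x) := fun x => hg.mono_set inter_subset_left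
  refine ⟨fun x => ∫ t in Ioo a b ∩ Iic x, g t, fun x y hxy => ?_, fun x => ?_,
    fun x hx y hy hxy => ?_⟩
  · exact setIntegral_mono_set (hi y) (Eventually.of_forall h0)
      (inter_subset_inter_right _ (Iic_subset_Iic.2 hxy)).eventuallyLE
  · rw [abs_of_nonneg (integral_nonneg h0)]
    exact setIntegral_mono_set hg (Eventually.of_forall h0) inter_subset_left.eventuallyLE
  · have hs : Ioo a b ∩ Iic y = (Ioo a b ∩ Iic x) ∪ Ioc x y := by
      ext t
      simp only [mem_inter_iff, mem_Ioo, mem_Iic, mem_union, mem_Ioc] at *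
      constructor
      · rintro ⟨h1, h2⟩
        rcases le_or_gt t x with h | h
        · exact Or.inl ⟨h1, h⟩
        · exact Or.inr ⟨h, h2⟩
      · rintro (⟨h1, h2⟩ | ⟨h1, h2⟩)
        · exact ⟨h1, h2.trans hxy⟩
        · exact ⟨⟨hx.1.trans h1, h2.trans_lt hy.2⟩, h2⟩
    have hd : Disjoint (Ioo a b ∩ Iic x) (Ioc x y) :=
      disjoint_left.2 fun t h1 h2 => not_lt.2 h1.2 h2.1
    dsimp only
    rw [hs, setIntegral_union hd measurableSet_Ioc (hi x)
      (hg.mono_set fun t ht => ⟨hx.1.trans ht.1, ht.2.trans_lt hy.2⟩)]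
    ring

theorem abs_le_of_abs_sub_le {a b C : ℝ} (hab : a < b) {u : ℝ → ℝ} (hu : IntegrableOn u (Ioo a b))
    (h : ∀ x ∈ Ioo a b, ∀ y ∈ Ioo a b, |u y - u x| ≤ C) {x : ℝ} (hx : x ∈ Ioo a b) :
    |u x| ≤ (∫ t in Ioo a b, |u t|) / (b - a) + C := by
  have h1 : ∫ t in Ioo a b, (|u x| - C) ≤ ∫ t in Ioo a b, |u t| := by
    refine setIntegral_mono_on (integrableOn_const (by simp)) hu.abs measurableSet_Ioo
      fun t ht => ?_
    have := h t ht x hx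
    have := abs_sub_abs_le_abs_sub (u x) (u t)
    linarith
  rw [setIntegral_const, smul_eq_mul, Real.volume_real_Ioo_of_le hab.le] at h1
  have : |u x| - C ≤ (∫ t in Ioo a b, |u t|) / (b - a) := by
    rw [le_div_iff₀ (sub_pos.2 hab)]; linarith
  linarith

theorem tendsto_integral_abs_sub {a b M : ℝ} {F : ℕ → ℝ → ℝ} {f g : ℝ → ℝ}
    (hF : ∀ k, AEStronglyMeasurable (F k) (volume.restrict (Ioo a b)))
    (hM : ∀ k, ∀ x ∈ Ioo a b, |F k x| ≤ M)
    (hl : ∀ x ∈ Ioo a b, Tendsto (fun k => F k x) atTop (𝓝 (f x)))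
    (hfg : ∀ᵐ x ∂volume.restrict (Ioo a b), g x = f x) :
    Tendsto (fun k => ∫ x in Ioo a b, |F k x - g x|) atTop (𝓝 0) := by
  have hgm : AEStronglyMeasurable g (volume.restrict (Ioo a b)) := by
    refine (aestronglyMeasurable_of_tendsto_ae atTop hF (g := f) ?_).congr
      (hfg.mono fun x hx => hx.symm)
    exact (ae_restrict_mem measurableSet_Ioo).mono hl
  have h0 : (0 : ℝ) = ∫ x in Ioo a b, (0 : ℝ) := by simp
  rw [h0]
  refine tendsto_integral_of_dominated_convergence (fun _ => M + M)
    (fun k => ((hF k).sub hgm).norm) (integrableOn_const (by simp)) (fun k => ?_) ?_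
  · filter_upwards [ae_restrict_mem measurableSet_Ioo, hfg] with x hx hgx
    have h1 : |f x| ≤ M := le_of_tendsto (hl x hx).abs (Eventually.of_forall fun k => hM k x hx)
    rw [hgx, Real.norm_eq_abs, abs_abs]
    exact (abs_sub _ _).trans (add_le_add (hM k x hx) h1)
  · filter_upwards [ae_restrict_mem measurableSet_Ioo, hfg] with x hx hgx
    have := ((hl x hx).sub_const (f x)).abs
    rw [sub_self, abs_zero] at this
    simpa [hgx] using this

theorem PsiHyp.exists_subseq_of_W2pRep {ψ : ℝ → ℝ} (hψ : PsiHyp ψ) {a b C₀ C : ℝ} (hab : a < b)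
    {U v w : ℕ → ℝ → ℝ} (hU : ∀ k, W2pRep 1 a b (U k) (v k) (w k))
    (hE : ∀ k, (∫ x in Ioo a b, |v k x|) + ∫ x in Ioo a b, ψ (v k x) * |w k x| ^ (1 : ℝ) ≤ C)
    (h0 : ∀ k, ∫ x in Ioo a b, |U k x| ≤ C₀) :
    ∃ φ : ℕ → ℕ, StrictMono φ ∧ ∃ (f : ℝ → ℝ) (Mp Mn Np Nn : Measure ℝ),
      MemX1 ψ a b f Mp Mn ∧ IsDerivMeasures a b (fun x => Psi1 ψ (uaD Mp Mn x)) Np Nn ∧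
      (∀ μ ∈ ({Mp, Mn, Np, Nn} : Set (Measure ℝ)),
        μ univ ≤ ENNReal.ofReal (2 * (C₀ / (b - a) + C + ∫ s, ψ s))) ∧
      Tendsto (fun k => ∫ x in Ioo a b, |U (φ k) x - f x|) atTop (𝓝 0) ∧
      Tendsto (fun k => ∫ x in Ioo a b, |Psi1 ψ (v (φ k) x) - Psi1 ψ (uaD Mp Mn x)|) atTop
        (𝓝 0) := by
  simp only [Real.rpow_one] at hE
  obtain ⟨B, hB⟩ := hψ.bounded
  have hψ0 : 0 ≤ ∫ s, ψ s := integral_nonneg fun s => (hψ.pos s).le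
  have hC₀ : 0 ≤ C₀ := (integral_nonneg fun x => abs_nonneg _).trans (h0 0)
  have hv0 : ∀ k, 0 ≤ ∫ x in Ioo a b, |v k x| := fun k => integral_nonneg fun x => abs_nonneg _
  have hw0 : ∀ k, 0 ≤ ∫ x in Ioo a b, ψ (v k x) * |w k x| := fun k =>
    integral_nonneg fun x => mul_nonneg (hψ.pos _).le (abs_nonneg _)
  have hC0 : 0 ≤ C := (add_nonneg (hv0 0) (hw0 0)).trans (hE 0)
  have hvC : ∀ k, ∫ x in Ioo a b, |v k x| ≤ C := fun k => by linarith [hE k, hw0 k]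
  have hwC : ∀ k, ∫ x in Ioo a b, ψ (v k x) * |w k x| ≤ C := fun k => by linarith [hE k, hv0 k]
  have hD0 : 0 ≤ C₀ / (b - a) := div_nonneg hC₀ (sub_pos.2 hab).le
  set M := C₀ / (b - a) + C + ∫ s, ψ s with hM
  have hCM : C ≤ M := by linarith
  have hvi : ∀ k, IntegrableOn (v k) (Ioo a b) := fun k => (hU k).2.2.2.1
  have hψi : ∀ k, IntegrableOn (fun x => ψ (v k x) * |w k x|) (Ioo a b) := fun k =>
    (hU k).2.2.2.2.1.abs.bdd_mul (c := B)
      (hψ.measurable.comp_aemeasurable (hvi k).aestronglyMeasurable.aemeasurable).aestronglyMeasurable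
      (Eventually.of_forall fun x => by
        rw [Real.norm_of_nonneg (hψ.pos _).le]; exact hB _)
  have hUv : ∀ k, ∀ x ∈ Ioo a b, ∀ y ∈ Ioo a b, U k y - U k x = ∫ t in x..y, v k t := by
    intro k x hx y hy
    have hs : uIcc x y ⊆ Ioo a b := ordConnected_Ioo.uIcc_subset hx hy
    exact (intervalIntegral.integral_eq_sub_of_hasDerivAt (fun t ht => (hU k).1 t (hs ht))
      ((hvi k).mono_set hs).intervalIntegrable).symm
  choose T hTm hTb hTd using fun k => exists_monotone_primitive (hvi k).abs fun x => abs_nonneg _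
  choose A hAm hAb hAd using fun k => exists_monotone_primitive (hψi k)
    fun x => mul_nonneg (hψ.pos _).le (abs_nonneg _)
  have hUT : ∀ k, ∀ x ∈ Ioo a b, ∀ y ∈ Ioo a b, x ≤ y → |U k y - U k x| ≤ T k y - T k x := by
    intro k x hx y hy hxy
    rw [hTd k x hx y hy hxy, hUv k x hx y hy, intervalIntegral.integral_of_le hxy]
    exact abs_integral_le_integral_abs
  have hUC : ∀ k, ∀ x ∈ Ioo a b, ∀ y ∈ Ioo a b, |U k y - U k x| ≤ C := by
    have : ∀ k, ∀ x ∈ Ioo a b, ∀ y ∈ Ioo a b, x ≤ y → |U k y - U k x| ≤ C := by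
      intro k x hx y hy hxy
      refine (hUT k x hx y hy hxy).trans ?_
      rw [hTd k x hx y hy hxy]
      refine (setIntegral_mono_set (hvi k).abs (Eventually.of_forall fun x => abs_nonneg _)
        ?_).trans (hvC k)
      exact (show Ioc x y ⊆ Ioo a b from
        fun t ht => ⟨hx.1.trans ht.1, ht.2.trans_lt hy.2⟩).eventuallyLE
    intro k x hx y hy
    rcases le_total x y with h | h
    · exact this k x hx y hy h
    · rw [abs_sub_comm]; exact this k y hy x hx h
  have hUM : ∀ k, ∀ x ∈ Ioo a b, |U k x| ≤ M := fun k x hx => by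
    have := abs_le_of_abs_sub_le hab (hU k).2.2.1 (hUC k) hx
    have h2 := div_le_div_of_nonneg_right (h0 k) (sub_pos.2 hab).le
    linarith
  have hPM : ∀ k, ∀ x ∈ Ioo a b, |Psi1 ψ (v k x)| ≤ M := fun k x hx => by
    rw [abs_of_pos (hψ.psi1_pos _)]
    linarith [hψ.psi1_lt (v k x)]
  have hvA : ∀ k, ∀ x ∈ Ioo a b, ∀ y ∈ Ioo a b, x ≤ y →
      |Psi1 ψ (v k y) - Psi1 ψ (v k x)| ≤ A k y - A k x := fun k x hx y hy hxy => by
    rw [hAd k x hx y hy hxy]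
    exact hψ.abs_psi1_sub_le (hU k).2.2.2.2.1 (hU k).2.1 hx hy hxy
  obtain ⟨φ₁, hφ₁, f, G₁, hG₁, hTG, hUf⟩ := helly_selection_bv U T hTm M
    (fun k x => (hTb k x).trans ((hvC k).trans hCM)) hUM hUT
  obtain ⟨φ₂, hφ₂, V, G₂, hG₂, hAG, hVl⟩ := helly_selection_bv (fun k x => Psi1 ψ (v (φ₁ k) x))
    (fun k => A (φ₁ k)) (fun k => hAm _) M
    (fun k x => (hAb _ x).trans ((hwC _).trans hCM)) (fun k => hPM _) (fun k => hvA _)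
  have hUf' : ∀ x ∈ Ioo a b, Tendsto (fun k => U (φ₁ (φ₂ k)) x) atTop (𝓝 (f x)) :=
    fun x hx => (hUf x hx).comp hφ₂.tendsto_atTop
  have hG₁M : ∀ x ∈ Ioo a b, |G₁ x| ≤ M := fun x _ =>
    le_of_tendsto (hTG x).abs
      (Eventually.of_forall fun k => (hTb _ x).trans ((hvC _).trans hCM))
  have hG₂M : ∀ x ∈ Ioo a b, |G₂ x| ≤ M := fun x _ =>
    le_of_tendsto (hAG x).abs
      (Eventually.of_forall fun k => (hAb _ x).trans ((hwC _).trans hCM))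
  have hfM : ∀ x ∈ Ioo a b, |f x| ≤ M := fun x hx =>
    le_of_tendsto (hUf x hx).abs (Eventually.of_forall fun k => hUM _ x hx)
  have hVM : ∀ x ∈ Ioo a b, |V x| ≤ M := fun x hx =>
    le_of_tendsto (hVl x hx).abs (Eventually.of_forall fun k => hPM _ x hx)
  obtain ⟨μ, ν, c, hμν, hμ, hν, hμM, hνM, hrep⟩ := exists_distrib_repr hab hG₁M hfM
    fun x hx y hy hxy => le_of_tendsto_of_tendsto' ((hUf y hy).sub (hUf x hx)).abs
      ((hTG y).sub (hTG x)) fun k => hUT _ x hx y hy hxy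
  obtain ⟨μ', ν', c', hμν', hμ', hν', hμM', hνM', hrep'⟩ := exists_distrib_repr hab hG₂M hVM
    fun x hx y hy hxy => le_of_tendsto_of_tendsto' ((hVl y hy).sub (hVl x hx)).abs
      ((hAG y).sub (hAG x)) fun k => hvA _ x hx y hy hxy
  have i1 : IsFiniteMeasure μ := ⟨hμM.trans_lt ENNReal.ofReal_lt_top⟩
  have i2 : IsFiniteMeasure ν := ⟨hνM.trans_lt ENNReal.ofReal_lt_top⟩
  have i3 : IsFiniteMeasure μ' := ⟨hμM'.trans_lt ENNReal.ofReal_lt_top⟩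
  have i4 : IsFiniteMeasure ν' := ⟨hνM'.trans_lt ENNReal.ofReal_lt_top⟩
  have hd := hrep.isDerivMeasures hab hμν hμ hν
  obtain ⟨hVD, hcp, hcn⟩ := hψ.limit_structure hrep hμν hd.1 hμ hν hUf' (fun k => hUv _)
    (fun k => hvi _) (fun k => hvC _) (fun k => hAm _) hG₂ hAG (fun k => hvA _) hVl
  have hrep'' : HasDistribRepr a b (fun x => Psi1 ψ (uaD μ ν x)) μ' ν' c' := by
    unfold HasDistribRepr at hrep' ⊢
    filter_upwards [hrep', hVD] with x h1 h2
    rw [h2, h1]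
  have hd' := hrep''.isDerivMeasures hab hμν' hμ' hν'
  refine ⟨φ₁ ∘ φ₂, hφ₁.comp hφ₂, f, μ, ν, μ', ν', ⟨hd, ⟨μ', ν', hd'⟩, hcp, hcn⟩, hd', ?_, ?_, ?_⟩
  · rintro m (rfl | rfl | rfl | rfl) <;> assumption
  · exact tendsto_integral_abs_sub (fun k => (hU _).2.2.1.aestronglyMeasurable) (fun k => hUM _)
      hUf' (Eventually.of_forall fun _ => rfl)
  · exact tendsto_integral_abs_sub
      (fun k => hψ.psi1_continuous.comp_aestronglyMeasurable (hvi _).aestronglyMeasurable)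
      (fun k => hPM _) hVl hVD

theorem abs_integral_sub_le_of_dist_le {α : Measure ℝ} [IsFiniteMeasure α] {g φ : ℝ → ℝ} {δ : ℝ}
    (hg : Integrable g α) (hφ : Integrable φ α) (h : ∀ x, dist (φ x) (g x) < δ) :
    |(∫ x, g x ∂α) - ∫ x, φ x ∂α| ≤ δ * α.real univ := by
  rw [← integral_sub hg hφ, ← Real.norm_eq_abs]
  refine norm_integral_le_of_norm_le_const (Eventually.of_forall fun x => ?_)
  rw [← dist_eq_norm, dist_comm]
  exact (h x).le

theorem IsDerivMeasures.tendsto_integral_of_contDiff {a b : ℝ} {f : ℕ → ℝ → ℝ} {F : ℝ → ℝ}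
    {α β : ℕ → Measure ℝ} {A B : Measure ℝ} (hk : ∀ k, IsDerivMeasures a b (f k) (α k) (β k))
    (h : IsDerivMeasures a b F A B)
    (hL : Tendsto (fun k => ∫ x in Ioo a b, |f k x - F x|) atTop (𝓝 0))
    {φ : ℝ → ℝ} (hφ : ContDiff ℝ 1 φ) (hs : tsupport φ ⊆ Ioo a b) :
    Tendsto (fun k => (∫ x, φ x ∂(α k)) - ∫ x, φ x ∂(β k)) atTop
      (𝓝 ((∫ x, φ x ∂A) - ∫ x, φ x ∂B)) := by
  have hcs : HasCompactSupport φ :=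
    isCompact_Icc.of_isClosed_subset (isClosed_tsupport _) (hs.trans Ioo_subset_Icc_self)
  have hcd : Continuous (deriv φ) := hφ.continuous_deriv le_rfl
  obtain ⟨C, hC⟩ := hcs.deriv.exists_bound_of_continuous hcd
  have hi : ∀ g : ℝ → ℝ, IntegrableOn g (Ioo a b) →
      IntegrableOn (fun x => g x * deriv φ x) (Ioo a b) := fun g hg =>
    Integrable.mul_bdd (c := C) hg hcd.aestronglyMeasurable (Eventually.of_forall hC)
  rw [tendsto_iff_dist_tendsto_zero]
  refine squeeze_zero (fun _ => dist_nonneg) (fun k => ?_) (by simpa using hL.mul_const C)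
  have e1 := (hk k).2.2.2.2.2.2 φ hφ hs
  have e2 := h.2.2.2.2.2.2 φ hφ hs
  have e3 : ((∫ x, φ x ∂(α k)) - ∫ x, φ x ∂(β k)) - ((∫ x, φ x ∂A) - ∫ x, φ x ∂B) =
      -∫ x in Ioo a b, (f k x - F x) * deriv φ x := by
    simp_rw [sub_mul]
    rw [integral_sub (hi _ (hk k).1) (hi _ h.1), e1, e2]
    ring
  rw [Real.dist_eq, e3, abs_neg, ← integral_mul_const]
  refine abs_integral_le_integral_abs.trans (integral_mono (hi _ ((hk k).1.sub h.1)).abs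
    (((hk k).1.sub h.1).abs.mul_const C) fun x => ?_)
  simp only [abs_mul]
  exact mul_le_mul_of_nonneg_left (hC x) (abs_nonneg _)

theorem IsDerivMeasures.tendsto_integral {a b K : ℝ} {f : ℕ → ℝ → ℝ} {F : ℝ → ℝ}
    {α β : ℕ → Measure ℝ} {A B : Measure ℝ} (hk : ∀ k, IsDerivMeasures a b (f k) (α k) (β k))
    (h : IsDerivMeasures a b F A B) (hα : ∀ k, (α k).real univ ≤ K)
    (hβ : ∀ k, (β k).real univ ≤ K)
    (hL : Tendsto (fun k => ∫ x in Ioo a b, |f k x - F x|) atTop (𝓝 0))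
    {g : ℝ → ℝ} (hg : Continuous g) (hs : tsupport g ⊆ Ioo a b) :
    Tendsto (fun k => (∫ x, g x ∂(α k)) - ∫ x, g x ∂(β k)) atTop
      (𝓝 ((∫ x, g x ∂A) - ∫ x, g x ∂B)) := by
  have hcs : ∀ φ : ℝ → ℝ, tsupport φ ⊆ Ioo a b → HasCompactSupport φ := fun φ hφ =>
    isCompact_Icc.of_isClosed_subset (isClosed_tsupport _) (hφ.trans Ioo_subset_Icc_self)
  have iA := h.2.1
  have iB := h.2.2.1
  have iα : ∀ k, IsFiniteMeasure (α k) := fun k => (hk k).2.1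
  have iβ : ∀ k, IsFiniteMeasure (β k) := fun k => (hk k).2.2.1
  have hK : 0 ≤ K := measureReal_nonneg.trans (hα 0)
  set S := 2 * K + A.real univ + B.real univ + 1
  have hS : 0 < S := by positivity
  refine Metric.tendsto_atTop.2 fun ε hε => ?_
  set δ := ε / (2 * S)
  have hδ : 0 < δ := by positivity
  have hδS : δ * S = ε / 2 := by simp only [δ]; field_simp
  obtain ⟨φ, hφ, hd, hsup⟩ := hg.exists_contDiff_approx 1 (continuous_const (y := δ)) fun _ => hδ
  have hφs : tsupport φ ⊆ Ioo a b := (closure_mono hsup).trans hs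
  have hgi : ∀ γ : Measure ℝ, IsFiniteMeasure γ → Integrable g γ := fun γ _ =>
    hg.integrable_of_hasCompactSupport (hcs g hs)
  have hφi : ∀ γ : Measure ℝ, IsFiniteMeasure γ → Integrable φ γ := fun γ _ =>
    hφ.continuous.integrable_of_hasCompactSupport (hcs φ hφs)
  obtain ⟨N, hN⟩ := Metric.tendsto_atTop.1
    (IsDerivMeasures.tendsto_integral_of_contDiff hk h hL hφ hφs) (ε / 2) (by positivity)
  refine ⟨N, fun k hkN => ?_⟩
  have h1 := abs_le.1 (abs_integral_sub_le_of_dist_le (hgi _ (iα k)) (hφi _ (iα k)) hd)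
  have h2 := abs_le.1 (abs_integral_sub_le_of_dist_le (hgi _ (iβ k)) (hφi _ (iβ k)) hd)
  have h3 := abs_le.1 (abs_integral_sub_le_of_dist_le (hgi _ iA) (hφi _ iA) hd)
  have h4 := abs_le.1 (abs_integral_sub_le_of_dist_le (hgi _ iB) (hφi _ iB) hd)
  have h5 := abs_lt.1 (hN k hkN)
  have h6 := mul_le_mul_of_nonneg_left (hα k) hδ.le
  have h7 := mul_le_mul_of_nonneg_left (hβ k) hδ.le
  have h8 : δ * S = 2 * (δ * K) + δ * A.real univ + δ * B.real univ + δ := by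
    simp only [S]; ring
  rw [Real.dist_eq, abs_lt]
  constructor <;> linarith [h1.1, h1.2, h2.1, h2.2, h3.1, h3.2, h4.1, h4.2, h5.1, h5.2]

theorem integral_abs_sub_le_add {X : Type*} [MeasurableSpace X] {m : Measure X} {f g h : X → ℝ}
    (hf : Integrable f m) (hg : Integrable g m) (hh : Integrable h m) :
    ∫ x, |f x - h x| ∂m ≤ (∫ x, |g x - f x| ∂m) + ∫ x, |g x - h x| ∂m := by
  refine le_of_le_of_eq ?_ (integral_add (hg.sub hf).abs (hg.sub hh).abs)
  refine integral_mono (hf.sub hh).abs ((hg.sub hf).abs.add (hg.sub hh).abs) fun x => ?_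
  simp only
  rw [abs_sub_comm (g x) (f x)]
  exact abs_sub_le _ _ _

theorem ae_eq_of_tendsto_integral_abs_sub {X : Type*} [MeasurableSpace X] {m : Measure X}
    {g : ℕ → X → ℝ} {f h : X → ℝ}
    (hf : Integrable f m) (hg : ∀ k, Integrable (g k) m) (hh : Integrable h m)
    (h1 : Tendsto (fun k => ∫ x, |g k x - f x| ∂m) atTop (𝓝 0))
    (h2 : Tendsto (fun k => ∫ x, |g k x - h x| ∂m) atTop (𝓝 0)) : ∀ᵐ x ∂m, f x = h x := by
  have hle : ∫ x, |f x - h x| ∂m ≤ 0 := by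
    refine ge_of_tendsto' (by simpa using h1.add h2) fun k =>
      integral_abs_sub_le_add hf (hg k) hh
  have h0 := (integral_eq_zero_iff_of_nonneg (fun x => abs_nonneg (f x - h x))
    (hf.sub hh).abs).1 (le_antisymm hle (integral_nonneg fun x => abs_nonneg _))
  filter_upwards [h0] with x hx
  exact sub_eq_zero.1 (abs_eq_zero.1 hx)

theorem exists_subseq_ae_tendsto {X : Type*} [MeasurableSpace X] {m : Measure X}
    {g : ℕ → X → ℝ} {f : X → ℝ} (hf : Integrable f m) (hg : ∀ k, Integrable (g k) m)
    (h : Tendsto (fun k => ∫ x, |g k x - f x| ∂m) atTop (𝓝 0)) :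
    ∃ φ : ℕ → ℕ, StrictMono φ ∧ ∀ᵐ x ∂m, Tendsto (fun k => g (φ k) x) atTop (𝓝 (f x)) := by
  refine (tendstoInMeasure_of_tendsto_eLpNorm one_ne_zero
    (fun k => (hg k).aestronglyMeasurable) hf.aestronglyMeasurable ?_).exists_seq_tendsto_ae
  have : ∀ k, eLpNorm (g k - f) 1 m = ENNReal.ofReal (∫ x, |g k x - f x| ∂m) := fun k => by
    rw [eLpNorm_one_eq_lintegral_enorm, ← ofReal_integral_norm_eq_lintegral_enorm ((hg k).sub hf)]
    rfl
  simp_rw [this]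
  simpa using ENNReal.tendsto_ofReal h

theorem PsiHyp.integrableOn_psi1 {ψ : ℝ → ℝ} (hψ : PsiHyp ψ) {a b : ℝ} {v : ℝ → ℝ}
    (hv : IntegrableOn v (Ioo a b)) : IntegrableOn (fun x => Psi1 ψ (v x)) (Ioo a b) :=
  Integrable.of_bound (hψ.psi1_continuous.comp_aestronglyMeasurable hv.aestronglyMeasurable)
    (∫ s, ψ s) (Eventually.of_forall fun x => by
      rw [Real.norm_of_nonneg (hψ.psi1_pos _).le]; exact (hψ.psi1_lt _).le)

theorem exists_W2pRep_of_FpRel_le {ψ : ℝ → ℝ} {p a b : ℝ} {u : ℝ → ℝ} {C : ℝ≥0∞} (hC : C ≠ ⊤)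
    (h : FpRel ψ p a b u ≤ C) {ε : ℝ} (hε : 0 < ε) :
    ∃ U v w : ℝ → ℝ, W2pRep p a b U v w ∧
      (∫ x in Ioo a b, |v x|) + ∫ x in Ioo a b, ψ (v x) * |w x| ^ p ≤ C.toReal + 1 ∧
      ∫ x in Ioo a b, |U x - u x| < ε := by
  have hlt : FpRel ψ p a b u < ENNReal.ofReal (C.toReal + 1) := by
    refine h.trans_lt ?_
    rw [ENNReal.lt_ofReal_iff_toReal_lt hC]
    linarith
  simp only [FpRel, iInf_lt_iff] at hlt
  obtain ⟨U, hU, hlt⟩ := hlt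
  obtain ⟨k, hk, hkε⟩ := ((frequently_lt_of_liminf_lt (by isBoundedDefault) hlt).and_eventually
    (hU.2.2.eventually_lt_const hε)).exists
  simp only [Fp, iInf_lt_iff] at hk
  obtain ⟨v, w, hrep, hE⟩ := hk
  exact ⟨U k, v, w, hrep, ((ENNReal.ofReal_lt_ofReal_iff (by positivity)).1 hE).le, hkε⟩

theorem integral_abs_le_add {a b : ℝ} {U u : ℝ → ℝ} (hU : IntegrableOn U (Ioo a b))
    (hu : IntegrableOn u (Ioo a b)) :
    ∫ x in Ioo a b, |U x| ≤ (∫ x in Ioo a b, |u x|) + ∫ x in Ioo a b, |U x - u x| := by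
  refine le_of_le_of_eq ?_ (integral_add hu.abs (hU.sub hu).abs)
  refine integral_mono hU.abs (hu.abs.add (hU.sub hu).abs) fun x => ?_
  have := abs_sub_abs_le_abs_sub (U x) (u x)
  simp only
  linarith

theorem PsiHyp.exists_W2pRep_near {ψ : ℝ → ℝ} (hψ : PsiHyp ψ) {a b C₀ : ℝ} (hab : a < b)
    {u : ℝ → ℝ} {μp μn νp νn : Measure ℝ} (hX : IsDerivMeasures a b u μp μn)
    (hv : IsDerivMeasures a b (fun x => Psi1 ψ (uaD μp μn x)) νp νn)
    (h0 : ∫ x in Ioo a b, |u x| ≤ C₀) {C : ℝ≥0∞} (hC : C ≠ ⊤) (h : FpRel ψ 1 a b u ≤ C) :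
    (∀ μ ∈ ({μp, μn, νp, νn} : Set (Measure ℝ)),
      μ univ ≤ ENNReal.ofReal (2 * ((C₀ + 1) / (b - a) + (C.toReal + 1) + ∫ s, ψ s))) ∧
    ∀ ε > 0, ∃ U v w : ℝ → ℝ, W2pRep 1 a b U v w ∧
      (∫ x in Ioo a b, |v x|) + ∫ x in Ioo a b, ψ (v x) * |w x| ^ (1 : ℝ) ≤ C.toReal + 1 ∧
      ∫ x in Ioo a b, |U x - u x| < ε ∧
      ∫ x in Ioo a b, |Psi1 ψ (v x) - Psi1 ψ (uaD μp μn x)| < ε := by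
  choose U v w hrep hE hUu using fun k : ℕ =>
    exists_W2pRep_of_FpRel_le hC h (Nat.one_div_pos_of_nat (α := ℝ) (n := k))
  have hUC : ∀ k, ∫ x in Ioo a b, |U k x| ≤ C₀ + 1 := fun k => by
    have := integral_abs_le_add (hrep k).2.2.1 hX.1
    have h2 : (1 : ℝ) / (k + 1) ≤ 1 := by
      rw [div_le_one (by positivity)]; linarith [Nat.cast_nonneg (α := ℝ) k]
    linarith [hUu k]
  have hUlim : Tendsto (fun k => ∫ x in Ioo a b, |U k x - u x|) atTop (𝓝 0) :=
    squeeze_zero (fun k => integral_nonneg fun x => abs_nonneg _) (fun k => (hUu k).le)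
      tendsto_one_div_add_atTop_nhds_zero_nat
  obtain ⟨φ, hφ, f, Mp, Mn, Np, Nn, hf, hN, hM, hl1, hl2⟩ :=
    hψ.exists_subseq_of_W2pRep hab hrep hE hUC
  have huf : ∀ᵐ x ∂volume.restrict (Ioo a b), u x = f x :=
    ae_eq_of_tendsto_integral_abs_sub hX.1 (fun k => (hrep (φ k)).2.2.1) hf.1.1
      (hUlim.comp hφ.tendsto_atTop) hl1
  have huaD := ae_restrict_of_ae (s := Ioo a b) (hX.uaD_ae_eq hf.1 huf)
  have hPsi : ∀ᵐ x ∂volume.restrict (Ioo a b),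
      Psi1 ψ (uaD μp μn x) = Psi1 ψ (uaD Mp Mn x) := huaD.mono fun x hx => by rw [hx]
  have hle := hX.le_le hf.1 huf
  have hle' := hv.le_le hN hPsi
  refine ⟨?_, fun ε hε => ?_⟩
  · rintro μ (rfl | rfl | rfl | rfl)
    · exact (hle.1 _).trans (hM _ (by simp))
    · exact (hle.2 _).trans (hM _ (by simp))
    · exact (hle'.1 _).trans (hM _ (by simp))
    · exact (hle'.2 _).trans (hM _ (by simp))
  · obtain ⟨k, hk1, hk2⟩ := (((hUlim.comp hφ.tendsto_atTop).eventually_lt_const hε).and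
      (hl2.eventually_lt_const hε)).exists
    refine ⟨U (φ k), v (φ k), w (φ k), hrep _, hE _, hk1, ?_⟩
    refine lt_of_eq_of_lt (integral_congr_ae ?_) hk2
    filter_upwards [hPsi] with x hx
    rw [hx]

theorem tendsto_integral_abs_sub_of_near {a b : ℝ} {F G : ℕ → ℝ → ℝ} {f : ℝ → ℝ} {φ : ℕ → ℕ}
    (hφ : StrictMono φ) (hF : ∀ k, IntegrableOn (F k) (Ioo a b))
    (hG : ∀ k, IntegrableOn (G k) (Ioo a b)) (hf : IntegrableOn f (Ioo a b))
    (hFG : ∀ k : ℕ, ∫ x in Ioo a b, |F k x - G k x| < 1 / ((k : ℝ) + 1))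
    (h : Tendsto (fun k => ∫ x in Ioo a b, |F (φ k) x - f x|) atTop (𝓝 0)) :
    Tendsto (fun k => ∫ x in Ioo a b, |G (φ k) x - f x|) atTop (𝓝 0) := by
  have h1 : Tendsto (fun k : ℕ => 1 / ((φ k : ℝ) + 1)) atTop (𝓝 0) :=
    tendsto_one_div_add_atTop_nhds_zero_nat.comp hφ.tendsto_atTop
  refine squeeze_zero (fun k => integral_nonneg fun x => abs_nonneg _) (fun k => ?_)
    (zero_add (0 : ℝ) ▸ h1.add h)
  exact (integral_abs_sub_le_add (hG _) (hF _) hf).trans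
    (add_le_add_left (hFG (φ k)).le _)

/-- compactness in `X¹_ψ(]a,b[)` for sequences with bounded relaxed energy. -/
theorem statement_4 (a b : ℝ) (hab : a < b) (ψ : ℝ → ℝ) (hψ : PsiHyp ψ)
    (u : ℕ → ℝ → ℝ) (μp μn νp νn : ℕ → Measure ℝ)
    (hX : ∀ k, MemX1 ψ a b (u k) (μp k) (μn k))
    (hv : ∀ k, IsDerivMeasures a b (fun x => Psi1 ψ (uaD (μp k) (μn k) x)) (νp k) (νn k))
    (hL1 : ∃ C0 : ℝ, ∀ k, ∫ x in Set.Ioo a b, |u k x| ≤ C0)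
    (hE : ∃ C : ℝ≥0∞, C ≠ ⊤ ∧ ∀ k, FpRel ψ 1 a b (u k) ≤ C) :
    ∃ φ : ℕ → ℕ, StrictMono φ ∧
    ∃ (U : ℝ → ℝ) (Mp Mn : Measure ℝ), MemX1 ψ a b U Mp Mn ∧
      -- `u_k ⇀ U` weakly* in `BV(]a,b[)`
      Tendsto (fun k => ∫ x in Set.Ioo a b, |u (φ k) x - U x|) atTop (𝓝 0) ∧
      (∀ f : ℝ → ℝ, Continuous f → tsupport f ⊆ Set.Ioo a b →
        Tendsto (fun k => (∫ x, f x ∂(μp (φ k))) - ∫ x, f x ∂(μn (φ k))) atTop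
          (𝓝 ((∫ x, f x ∂Mp) - ∫ x, f x ∂Mn))) ∧
      -- `Ψ₁∘(u_k')ᵃ ⇀ Ψ₁∘(U')ᵃ` weakly* in `BV(]a,b[)`
      (∃ Np Nn : Measure ℝ,
        IsDerivMeasures a b (fun x => Psi1 ψ (uaD Mp Mn x)) Np Nn ∧
        Tendsto (fun k => ∫ x in Set.Ioo a b,
            |Psi1 ψ (uaD (μp (φ k)) (μn (φ k)) x) - Psi1 ψ (uaD Mp Mn x)|) atTop (𝓝 0) ∧
        ∀ f : ℝ → ℝ, Continuous f → tsupport f ⊆ Set.Ioo a b →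
          Tendsto (fun k => (∫ x, f x ∂(νp (φ k))) - ∫ x, f x ∂(νn (φ k))) atTop
            (𝓝 ((∫ x, f x ∂Np) - ∫ x, f x ∂Nn))) ∧
      -- `(u_k')ᵃ → (U')ᵃ` pointwise `L¹`-a.e. in `]a,b[`
      (∀ᵐ x ∂(MeasureTheory.volume.restrict (Set.Ioo a b)),
        Tendsto (fun k => uaD (μp (φ k)) (μn (φ k)) x) atTop (𝓝 (uaD Mp Mn x))) := by
  obtain ⟨C₀, hC₀⟩ := hL1
  obtain ⟨C, hC, hCk⟩ := hE
  have hnear := fun k => hψ.exists_W2pRep_near hab (hX k).1 (hv k) (hC₀ k) hC (hCk k)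
  set K := 2 * ((C₀ + 1) / (b - a) + (C.toReal + 1) + ∫ s, ψ s) with hK
  have hK0 : 0 ≤ K := by
    have h1 : 0 ≤ C₀ := (integral_nonneg fun x => abs_nonneg _).trans (hC₀ 0)
    have h2 : 0 ≤ ∫ s, ψ s := integral_nonneg fun s => (hψ.pos s).le
    have h3 : 0 < b - a := sub_pos.2 hab
    positivity
  have hmass : ∀ k, ∀ μ ∈ ({μp k, μn k, νp k, νn k} : Set (Measure ℝ)), μ.real univ ≤ K :=
    fun k μ hμ => ENNReal.toReal_le_of_le_ofReal hK0 ((hnear k).1 μ hμ)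
  choose F v w hrep hEn hFu hPv using fun k : ℕ =>
    (hnear k).2 (1 / ((k : ℝ) + 1)) Nat.one_div_pos_of_nat
  have hFC : ∀ k, ∫ x in Ioo a b, |F k x| ≤ C₀ + 1 := fun k => by
    have := integral_abs_le_add (hrep k).2.2.1 (hX k).1.1
    have h2 : (1 : ℝ) / (k + 1) ≤ 1 := by
      rw [div_le_one (by positivity)]; linarith [Nat.cast_nonneg (α := ℝ) k]
    linarith [hFu k, hC₀ k]
  obtain ⟨φ₁, hφ₁, U, Mp, Mn, Np, Nn, hU, hN, -, hl1, hl2⟩ :=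
    hψ.exists_subseq_of_W2pRep hab hrep hEn hFC
  have hu := tendsto_integral_abs_sub_of_near hφ₁ (fun k => (hrep k).2.2.1) (fun k => (hX k).1.1)
    hU.1.1 hFu hl1
  have hP := tendsto_integral_abs_sub_of_near hφ₁
    (fun k => hψ.integrableOn_psi1 (hrep k).2.2.2.1) (fun k => (hv k).1) hN.1 hPv hl2
  obtain ⟨φ₂, hφ₂, hae⟩ := exists_subseq_ae_tendsto hN.1 (fun k => (hv (φ₁ k)).1) hP
  have hu' := hu.comp hφ₂.tendsto_atTop
  have hP' := hP.comp hφ₂.tendsto_atTop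
  refine ⟨φ₁ ∘ φ₂, hφ₁.comp hφ₂, U, Mp, Mn, hU, hu', fun g hg hs => ?_,
    ⟨Np, Nn, hN, hP', fun g hg hs => ?_⟩, hae.mono fun x hx => hψ.tendsto_of_psi1 hx⟩
  · exact IsDerivMeasures.tendsto_integral (fun k => (hX (φ₁ (φ₂ k))).1) hU.1
      (fun k => hmass (φ₁ (φ₂ k)) _ (by simp)) (fun k => hmass (φ₁ (φ₂ k)) _ (by simp)) hu' hg hs
  · exact IsDerivMeasures.tendsto_integral (fun k => hv (φ₁ (φ₂ k))) hN
      (fun k => hmass (φ₁ (φ₂ k)) _ (by simp)) (fun k => hmass (φ₁ (φ₂ k)) _ (by simp)) hP' hg hs
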